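/- An allocation path G ∈ Path[x,b] is optimal if and only if there exist an optimal assignment map S and, for each i ∈ {1,…,k} with S^{-1}(i) ≠ ∅, an optimal transport path G_i from m(b_i)·δ_{x_i} to b_i, such that the graphs G_i are pairwise disjoint and G is their union. -/

import Mathlib

open scoped BigOperators RealInnerProductSpace

noncomputable section

attribute [local instance] Classical.propDecidable

/-- Points of the ambient Euclidean space `ℝ^m`. -/
abbrev Pt (m : ℕ) := EuclideanSpace ℝ (Fin m)

/-- A weighted directed graph in `ℝ^m`: a finite vertex set, a finite set of
directed edges (ordered pairs of points, viewed as directed line segments), and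
a weight function. -/
structure WDG (m : ℕ) where
  V : Finset (Pt m)
  E : Finset (Pt m × Pt m)
  w : Pt m × Pt m → ℝ

namespace WDG

variable {m : ℕ}

/-- Edges join distinct vertices of the graph and carry positive weight. -/
def edgesOK (G : WDG m) : Prop :=
  ∀ e ∈ G.E, e.1 ∈ G.V ∧ e.2 ∈ G.V ∧ e.1 ≠ e.2 ∧ 0 < G.w e

/-- The underlying undirected (simple) graph. -/
def undirected (G : WDG m) : SimpleGraph (Pt m) :=
  SimpleGraph.fromRel (fun u v => (u, v) ∈ G.E)

/-- The cost `M_α(G) = Σ_{e ∈ E(G)} w(e)^α · length(e)`. -/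
def cost (α : ℝ) (G : WDG m) : ℝ :=
  ∑ e ∈ G.E, (G.w e) ^ α * dist e.1 e.2

/-- Total weight of edges starting at `v`. -/
def outflow (G : WDG m) (v : Pt m) : ℝ :=
  ∑ e ∈ G.E.filter (fun e => e.1 = v), G.w e

/-- Total weight of edges ending at `v`. -/
def inflow (G : WDG m) (v : Pt m) : ℝ :=
  ∑ e ∈ G.E.filter (fun e => e.2 = v), G.w e

end WDG

/-- Atomic measures are represented as finitely supported functions `ℝ^m →₀ ℝ`
with nonnegative values; `AtomicOn X c` also requires the atoms to lie in `X`. -/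
def AtomicOn {m : ℕ} (X : Set (Pt m)) (c : Pt m →₀ ℝ) : Prop :=
  (∀ z, 0 ≤ c z) ∧ ↑c.support ⊆ X

/-- The mass `m(c)` of an atomic measure. -/
def massOf {m : ℕ} (c : Pt m →₀ ℝ) : ℝ := c.sum fun _ t => t

/-- `G` is a transport path from `a` to `b` inside `X`: its vertices lie in `X`
and contain the atoms of `a` and `b`, its underlying undirected graph has no
cycles, and the balance equation holds at every vertex. -/
def IsTransportPath {m : ℕ} (X : Set (Pt m)) (G : WDG m) (a b : Pt m →₀ ℝ) : Prop :=
  G.edgesOK ∧ ↑G.V ⊆ X ∧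
  (∀ z ∈ a.support, z ∈ G.V) ∧ (∀ z ∈ b.support, z ∈ G.V) ∧
  G.undirected.IsAcyclic ∧
  ∀ v : Pt m, G.outflow v - G.inflow v = a v - b v

/-- `d_α(a,b)`: the minimal cost of a transport path from `a` to `b`. -/
def dCost {m : ℕ} (X : Set (Pt m)) (α : ℝ) (a b : Pt m →₀ ℝ) : ℝ :=
  sInf (WDG.cost α '' {G : WDG m | IsTransportPath X G a b})

/-- An optimal transport path from `a` to `b`. -/
def IsOptimalTP {m : ℕ} (X : Set (Pt m)) (α : ℝ) (G : WDG m) (a b : Pt m →₀ ℝ) : Prop :=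
  IsTransportPath X G a b ∧
    ∀ G' : WDG m, IsTransportPath X G' a b → WDG.cost α G ≤ WDG.cost α G'

/-- The atomic probability measure `b = Σ_j n_j δ_{y_j}` of households. -/
def bMeas {m ℓ : ℕ} (y : Fin ℓ → Pt m) (n : Fin ℓ → ℝ) : Pt m →₀ ℝ :=
  ∑ j, Finsupp.single (y j) (n j)

/-- An allocation path from the factory locations `x` to the households `(y,n)`:
a transport path to `b` from some atomic probability measure supported on the
factory locations. -/
def IsAllocPath {m k ℓ : ℕ} (X : Set (Pt m)) (x : Fin k → Pt m)
    (y : Fin ℓ → Pt m) (n : Fin ℓ → ℝ) (G : WDG m) : Prop :=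
  ∃ a : Pt m →₀ ℝ, (∀ z, 0 ≤ a z) ∧ ↑a.support ⊆ Set.range x ∧ massOf a = 1 ∧
    IsTransportPath X G a (bMeas y n)

/-- An optimal allocation path: it minimizes `M_α` over all allocation paths. -/
def IsOptimalAllocPath {m k ℓ : ℕ} (X : Set (Pt m)) (α : ℝ) (x : Fin k → Pt m)
    (y : Fin ℓ → Pt m) (n : Fin ℓ → ℝ) (G : WDG m) : Prop :=
  IsAllocPath X x y n G ∧
    ∀ G' : WDG m, IsAllocPath X x y n G' → WDG.cost α G ≤ WDG.cost α G'

/-- For an assignment map `S`, the part `b_i = Σ_{j : S(j) = i} n_j δ_{y_j}`. -/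
def bPart {m k ℓ : ℕ} (y : Fin ℓ → Pt m) (n : Fin ℓ → ℝ) (S : Fin ℓ → Fin k)
    (i : Fin k) : Pt m →₀ ℝ :=
  ∑ j ∈ Finset.univ.filter (fun j => S j = i), Finsupp.single (y j) (n j)

/-- The mass `m(b_i) = Σ_{j : S(j) = i} n_j`. -/
def mB {k ℓ : ℕ} (n : Fin ℓ → ℝ) (S : Fin ℓ → Fin k) (i : Fin k) : ℝ :=
  ∑ j ∈ Finset.univ.filter (fun j => S j = i), n j

/-- `E_α(S) = Σ_i d_α(m(b_i) δ_{x_i}, b_i)`. -/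
def Ealpha {m k ℓ : ℕ} (X : Set (Pt m)) (α : ℝ) (x : Fin k → Pt m)
    (y : Fin ℓ → Pt m) (n : Fin ℓ → ℝ) (S : Fin ℓ → Fin k) : ℝ :=
  ∑ i, dCost X α (Finsupp.single (x i) (mB n S i)) (bPart y n S i)

/-- An optimal assignment map minimizes `E_α` over all assignment maps. -/
def IsOptimalAssign {m k ℓ : ℕ} (X : Set (Pt m)) (α : ℝ) (x : Fin k → Pt m)
    (y : Fin ℓ → Pt m) (n : Fin ℓ → ℝ) (S : Fin ℓ → Fin k) : Prop :=
  ∀ S' : Fin ℓ → Fin k, Ealpha X α x y n S ≤ Ealpha X α x y n S'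

/-- `ρ_α(σ,ε)`: equals `(σ/ε)^α − (σ/ε − 1)^α` for `σ > ε` (and for `σ = ε` when
`α ∈ (0,1)`), and equals `1` when `σ = ε` (covering also the convention for `α = 0`). -/
def rho (α σ ε : ℝ) : ℝ :=
  if σ = ε then 1 else (σ / ε) ^ α - (σ / ε - 1) ^ α


/-- `G` is the disjoint union of the subgraphs `Gi`: the `Gi` have pairwise
disjoint vertex sets, each is a subgraph of `G` (with matching weights), and
the edges of `G` are exactly the (disjoint) union of their edges. -/
def IsDisjointUnion {m k : ℕ} (G : WDG m) (Gi : Fin k → WDG m) : Prop :=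
  (∀ i i' : Fin k, i ≠ i' → Disjoint (Gi i).V (Gi i').V) ∧
  (∀ i, (Gi i).V ⊆ G.V) ∧
  (∀ i, (Gi i).E ⊆ G.E) ∧
  (∀ i, ∀ e ∈ (Gi i).E, (Gi i).w e = G.w e) ∧
  G.E = Finset.univ.biUnion (fun i => (Gi i).E)

/-- The projection coordinate `π(z) = ⟨z − p, v⟩` along the line through `p`
in direction `v`. -/
def proj {m : ℕ} (p v z : Pt m) : ℝ := ⟪z - p, v⟫

/-- The constant `C = √(m−1)/(2^{1−(m−1)(1−α)} − 1) + 1`. -/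
def Cconst (m : ℕ) (α : ℝ) : ℝ :=
  Real.sqrt ((m : ℝ) - 1) / ((2 : ℝ) ^ (1 - ((m : ℝ) - 1) * (1 - α)) - 1) + 1


/-- The cost density of a signed flow: only the positive direction is charged. -/
def posRpow (α s : ℝ) : ℝ := if 0 < s then s ^ α else 0

lemma posRpow_of_nonpos (α : ℝ) {s : ℝ} (hs : s ≤ 0) : posRpow α s = 0 :=
  if_neg hs.not_gt

lemma posRpow_of_pos (α : ℝ) {s : ℝ} (hs : 0 < s) : posRpow α s = s ^ α := if_pos hs

lemma posRpow_nonneg (α s : ℝ) : 0 ≤ posRpow α s := by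
  unfold posRpow; split_ifs with h
  · positivity
  · rfl

lemma posRpow_mono {α : ℝ} (hα : 0 ≤ α) {s t : ℝ} (hst : s ≤ t) :
    posRpow α s ≤ posRpow α t := by
  rcases le_or_gt s 0 with hs | hs
  · rw [posRpow_of_nonpos α hs]; exact posRpow_nonneg α t
  · rw [posRpow_of_pos α hs, posRpow_of_pos α (hs.trans_le hst)]
    exact Real.rpow_le_rpow hs.le hst hα

lemma posRpow_add_le {α : ℝ} (hα : 0 ≤ α) (hα1 : α ≤ 1) (s t : ℝ) :
    posRpow α (s + t) ≤ posRpow α s + posRpow α t := by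
  rcases le_or_gt s 0 with hs | hs
  · linarith [posRpow_mono hα (show s + t ≤ t by linarith), posRpow_nonneg α s]
  rcases le_or_gt t 0 with ht | ht
  · linarith [posRpow_mono hα (show s + t ≤ s by linarith), posRpow_nonneg α t]
  rw [posRpow_of_pos α hs, posRpow_of_pos α ht, posRpow_of_pos α (add_pos hs ht)]
  exact Real.rpow_add_le_add_rpow hs.le ht.le hα hα1

lemma posRpow_sum_le {α : ℝ} (hα : 0 ≤ α) (hα1 : α ≤ 1) {ι : Type*} (s : Finset ι) (g : ι → ℝ) :
    posRpow α (∑ i ∈ s, g i) ≤ ∑ i ∈ s, posRpow α (g i) := by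
  induction s using Finset.induction_on with
  | empty => simp [posRpow]
  | insert i s hi ih =>
    rw [Finset.sum_insert hi, Finset.sum_insert hi]
    linarith [posRpow_add_le hα hα1 (g i) (∑ j ∈ s, g j)]

/-- Slope of the tangent line of `posRpow α` (zero on the nonpositive half line). -/
def tangentSlope (α s : ℝ) : ℝ := if 0 < s then α * (s ^ α / s) else 0

lemma posRpow_add_le_tangent {α : ℝ} (hα : 0 ≤ α) (hα1 : α < 1) {s h : ℝ} (hs : 0 < s)
    (hsh : 0 ≤ s + h) : posRpow α (s + h) ≤ posRpow α s + tangentSlope α s * h := by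
  have h1 : posRpow α (s + h) ≤ (s + h) ^ α := by
    unfold posRpow; split_ifs
    · rfl
    · positivity
  have h2 : (1 + h / s) ^ α ≤ 1 + α * (h / s) :=
    rpow_one_add_le_one_add_mul_self (by rw [le_div_iff₀ hs]; linarith) hα hα1.le
  have h3 : (s + h) ^ α = s ^ α * (1 + h / s) ^ α := by
    rw [← Real.mul_rpow hs.le]
    · congr 1; field_simp
    · have : 1 + h / s = (s + h) / s := by field_simp
      rw [this]; positivity
  have h4 := mul_le_mul_of_nonneg_left h2 (Real.rpow_nonneg hs.le α)
  rw [posRpow_of_pos α hs, tangentSlope, if_pos hs]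
  calc posRpow α (s + h) ≤ s ^ α * (1 + α * (h / s)) := by rw [h3] at h1; linarith
    _ = _ := by ring

lemma posRpow_add_lt_tangent {α : ℝ} (hα : 0 < α) (hα1 : α < 1) {s h : ℝ} (hs : 0 < s)
    (hsh : 0 ≤ s + h) (hh : h ≠ 0) :
    posRpow α (s + h) < posRpow α s + tangentSlope α s * h := by
  have h1 : posRpow α (s + h) ≤ (s + h) ^ α := by
    unfold posRpow; split_ifs
    · rfl
    · positivity
  have h2 : (1 + h / s) ^ α < 1 + α * (h / s) :=
    rpow_one_add_lt_one_add_mul_self (by rw [le_div_iff₀ hs]; linarith)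
      (div_ne_zero hh hs.ne') hα hα1
  have h3 : (s + h) ^ α = s ^ α * (1 + h / s) ^ α := by
    rw [← Real.mul_rpow hs.le]
    · congr 1; field_simp
    · have : 1 + h / s = (s + h) / s := by field_simp
      rw [this]; positivity
  have h4 := mul_lt_mul_of_pos_left h2 (Real.rpow_pos_of_pos hs α)
  rw [posRpow_of_pos α hs, tangentSlope, if_pos hs]
  calc posRpow α (s + h) < s ^ α * (1 + α * (h / s)) := by rw [h3] at h1; linarith
    _ = _ := by ring

/-- Moving along a direction of nonpositive first variation until a coordinate vanishes. -/
lemma exists_shift_of_descent {ι : Type*} (s : Finset ι) {α : ℝ} (hα : 0 ≤ α) (hα1 : α < 1)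
    (c F χ : ι → ℝ) (hc : ∀ i ∈ s, 0 ≤ c i) (hsupp : ∀ i ∈ s, χ i ≠ 0 → F i ≠ 0)
    (hL : ∑ i ∈ s, c i * (tangentSlope α (F i) * χ i) ≤ 0)
    (hneg : ∃ i ∈ s, F i * χ i < 0) :
    ∃ t : ℝ, (∀ i ∈ s, 0 ≤ F i * (F i + t * χ i)) ∧
      (∃ i ∈ s, F i ≠ 0 ∧ F i + t * χ i = 0) ∧
      ∑ i ∈ s, c i * posRpow α (F i + t * χ i) ≤ ∑ i ∈ s, c i * posRpow α (F i) ∧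
      (0 < α → (∃ i ∈ s, 0 < F i ∧ χ i ≠ 0 ∧ 0 < c i) →
        ∑ i ∈ s, c i * posRpow α (F i + t * χ i) < ∑ i ∈ s, c i * posRpow α (F i)) := by
  set T := s.filter (fun i => F i * χ i < 0) with hT
  have hTne : T.Nonempty := by
    obtain ⟨i, hi, hi'⟩ := hneg
    exact ⟨i, by simp [hT, hi, hi']⟩
  obtain ⟨i₀, hi₀, hmin⟩ := T.exists_min_image (fun i => F i ^ 2 / (-(F i * χ i))) hTne
  simp only [hT, Finset.mem_filter] at hi₀ hmin
  set t := F i₀ ^ 2 / (-(F i₀ * χ i₀)) with ht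
  have hF₀ : F i₀ ≠ 0 := by rintro h; simp [h] at hi₀
  have htpos : 0 < t := by
    have : 0 < -(F i₀ * χ i₀) := by linarith [hi₀.2]
    positivity
  have hsign : ∀ i ∈ s, 0 ≤ F i * (F i + t * χ i) := by
    intro i hi
    rcases le_or_gt 0 (F i * χ i) with h | h
    · nlinarith [mul_nonneg htpos.le h, sq_nonneg (F i)]
    · have h1 := hmin i ⟨hi, h⟩
      rw [le_div_iff₀ (by linarith)] at h1
      nlinarith
  have hterm : ∀ i ∈ s, c i * posRpow α (F i + t * χ i) ≤
      c i * posRpow α (F i) + t * (c i * (tangentSlope α (F i) * χ i)) := by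
    intro i hi
    have h0 := hsign i hi
    rcases lt_trichotomy (F i) 0 with h | h | h
    · have : F i + t * χ i ≤ 0 := by
        by_contra hcon
        push Not at hcon
        nlinarith [mul_neg_of_neg_of_pos h hcon]
      rw [posRpow_of_nonpos α this, tangentSlope, if_neg h.le.not_gt, posRpow_of_nonpos α h.le]
      simp
    · have : χ i = 0 := by
        by_contra hcon
        exact hsupp i hi hcon h
      simp [this]
    · have h1 : 0 ≤ F i + t * χ i := nonneg_of_mul_nonneg_right h0 h
      have h2 := mul_le_mul_of_nonneg_left (posRpow_add_le_tangent hα hα1 h h1) (hc i hi)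
      linarith
  refine ⟨t, hsign, ⟨i₀, hi₀.1, hF₀, ?_⟩, ?_, ?_⟩
  · have hχ : χ i₀ ≠ 0 := by rintro h; simp [h] at hi₀
    rw [ht]; field_simp; ring
  · calc _ ≤ ∑ i ∈ s, (c i * posRpow α (F i) + t * (c i * (tangentSlope α (F i) * χ i))) :=
          Finset.sum_le_sum hterm
      _ = ∑ i ∈ s, c i * posRpow α (F i) +
            t * ∑ i ∈ s, c i * (tangentSlope α (F i) * χ i) := by
          rw [Finset.sum_add_distrib, Finset.mul_sum]
      _ ≤ _ := by nlinarith
  · rintro hα' ⟨i, hi, hFi, hχi, hci⟩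
    calc _ < ∑ i ∈ s, (c i * posRpow α (F i) + t * (c i * (tangentSlope α (F i) * χ i))) := by
          refine Finset.sum_lt_sum hterm ⟨i, hi, ?_⟩
          have h1 : 0 ≤ F i + t * χ i := nonneg_of_mul_nonneg_right (hsign i hi) hFi
          have h2 := mul_lt_mul_of_pos_left
            (posRpow_add_lt_tangent hα' hα1 hFi h1 (mul_ne_zero htpos.ne' hχi)) hci
          linarith
      _ = ∑ i ∈ s, c i * posRpow α (F i) +
            t * ∑ i ∈ s, c i * (tangentSlope α (F i) * χ i) := by
          rw [Finset.sum_add_distrib, Finset.mul_sum]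
      _ ≤ _ := by nlinarith

/-- Along any line in the space of flows one may move, without increasing the concave cost and
without sign changes, until some coordinate vanishes. -/
lemma exists_shift {ι : Type*} (s : Finset ι) {α : ℝ} (hα : 0 ≤ α) (hα1 : α < 1)
    (c F χ : ι → ℝ) (hc : ∀ i ∈ s, 0 ≤ c i) (hsupp : ∀ i ∈ s, χ i ≠ 0 → F i ≠ 0)
    (hne : ∃ i ∈ s, χ i ≠ 0) :
    ∃ t : ℝ, (∀ i ∈ s, 0 ≤ F i * (F i + t * χ i)) ∧
      (∃ i ∈ s, F i ≠ 0 ∧ F i + t * χ i = 0) ∧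
      ∑ i ∈ s, c i * posRpow α (F i + t * χ i) ≤ ∑ i ∈ s, c i * posRpow α (F i) ∧
      (0 < α → (∃ i ∈ s, 0 < F i ∧ χ i ≠ 0 ∧ 0 < c i) →
        ∑ i ∈ s, c i * posRpow α (F i + t * χ i) < ∑ i ∈ s, c i * posRpow α (F i)) := by
  have key : ∀ σ : ℝ, σ ≠ 0 → (∑ i ∈ s, c i * (tangentSlope α (F i) * (σ * χ i)) ≤ 0) →
      (∃ i ∈ s, F i * (σ * χ i) < 0) → _ := fun σ hσ h1 h2 =>
    exists_shift_of_descent s hα hα1 c F (fun i => σ * χ i) hc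
      (fun i hi h => hsupp i hi (right_ne_zero_of_mul h)) h1 h2
  suffices h : ∃ σ : ℝ, σ ≠ 0 ∧ (∑ i ∈ s, c i * (tangentSlope α (F i) * (σ * χ i)) ≤ 0) ∧
      (∃ i ∈ s, F i * (σ * χ i) < 0) by
    obtain ⟨σ, hσ, h1, h2⟩ := h
    obtain ⟨t, ht⟩ := key σ hσ h1 h2
    refine ⟨t * σ, ?_⟩
    simp only [← mul_assoc] at ht
    obtain ⟨h3, h4, h5, h6⟩ := ht
    exact ⟨h3, h4, h5, fun h ⟨i, hi, hF, hχ, hci⟩ => h6 h ⟨i, hi, hF, mul_ne_zero hσ hχ, hci⟩⟩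
  have hscale : ∀ σ : ℝ, ∑ i ∈ s, c i * (tangentSlope α (F i) * (σ * χ i)) =
      σ * ∑ i ∈ s, c i * (tangentSlope α (F i) * χ i) := by
    intro σ
    rw [Finset.mul_sum]
    exact Finset.sum_congr rfl fun i _ => by ring
  have hlt : ∀ σ : ℝ, ∑ i ∈ s, c i * (tangentSlope α (F i) * (σ * χ i)) < 0 →
      ∃ i ∈ s, F i * (σ * χ i) < 0 := by
    intro σ h
    obtain ⟨i, hi, hi'⟩ := Finset.exists_lt_of_sum_lt
      (h.trans_eq (Finset.sum_const_zero (s := s) (M := ℝ)).symm)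
    refine ⟨i, hi, ?_⟩
    have h1 : 0 < F i := by
      by_contra hcon
      simp [tangentSlope, hcon] at hi'
    have h2 : σ * χ i < 0 := by
      by_contra hcon
      push Not at hcon
      have : 0 ≤ tangentSlope α (F i) := by
        rw [tangentSlope, if_pos h1]; positivity
      have := mul_nonneg (hc i hi) (mul_nonneg this hcon)
      linarith
    exact mul_neg_of_pos_of_neg h1 h2
  rcases lt_trichotomy (∑ i ∈ s, c i * (tangentSlope α (F i) * χ i)) 0 with h | h | h
  · have h1 := hscale 1
    exact ⟨1, one_ne_zero, by linarith, hlt 1 (by linarith)⟩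
  · obtain ⟨i, hi, hχ⟩ := hne
    have hF := hsupp i hi hχ
    rcases lt_or_gt_of_ne (mul_ne_zero hF hχ) with h2 | h2
    · exact ⟨1, one_ne_zero, by rw [hscale, h]; simp, i, hi, by simpa using h2⟩
    · exact ⟨-1, by norm_num, by rw [hscale, h]; simp, i, hi, by nlinarith⟩
  · have h1 := hscale (-1)
    exact ⟨-1, by norm_num, by linarith, hlt (-1) (by linarith)⟩

/-- `f` is an antisymmetric flow on the finite vertex set `V`, with net supply `a - b`. -/
structure IsFlow {m : ℕ} (V : Finset (Pt m)) (f : Pt m → Pt m → ℝ) (a b : Pt m →₀ ℝ) : Prop where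
  anti : ∀ u v, f v u = -f u v
  mem : ∀ u v, f u v ≠ 0 → u ∈ V
  div : ∀ v, ∑ u ∈ V, f v u = a v - b v
  nonneg : ∀ z, 0 ≤ a z
  source_mem : ∀ z, a z ≠ 0 → z ∈ V
  sink_mem : ∀ z, b z ≠ 0 → z ∈ V

/-- The cost of an antisymmetric flow. -/
def flowCost {m : ℕ} (α : ℝ) (V : Finset (Pt m)) (f : Pt m → Pt m → ℝ) : ℝ :=
  ∑ p ∈ V ×ˢ V, dist p.1 p.2 * posRpow α (f p.1 p.2)

/-- The support graph of a flow. -/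
def flowGraph {m : ℕ} (f : Pt m → Pt m → ℝ) : SimpleGraph (Pt m) :=
  SimpleGraph.fromRel fun u v => f u v ≠ 0

section Flow

variable {m : ℕ}

lemma antisymm_self {f : Pt m → Pt m → ℝ} (h : ∀ u v, f v u = -f u v) (u : Pt m) :
    f u u = 0 := by linarith [h u u]

lemma flowGraph_adj {f : Pt m → Pt m → ℝ} (h : ∀ u v, f v u = -f u v) (u v : Pt m) :
    (flowGraph f).Adj u v ↔ f u v ≠ 0 := by
  rw [flowGraph, SimpleGraph.fromRel_adj, h u v]
  constructor
  · rintro ⟨-, h | h⟩ <;> simpa using h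
  · intro h1
    exact ⟨by rintro rfl; exact h1 (antisymm_self h u), Or.inl h1⟩

lemma IsFlow.mem_right {V : Finset (Pt m)} {f : Pt m → Pt m → ℝ} {a b : Pt m →₀ ℝ}
    (h : IsFlow V f a b) (u v : Pt m) (huv : f u v ≠ 0) : v ∈ V :=
  h.mem v u (by rw [h.anti u v]; simpa using huv)

lemma sum_antisymm_eq_zero {K : Finset (Pt m)} {f : Pt m → Pt m → ℝ}
    (h : ∀ u v, f v u = -f u v) : ∑ v ∈ K, ∑ u ∈ K, f v u = 0 := by
  have h1 : ∑ v ∈ K, ∑ u ∈ K, f v u = -∑ v ∈ K, ∑ u ∈ K, f v u := by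
    conv_lhs => rw [Finset.sum_comm]
    simp only [← Finset.sum_neg_distrib]
    exact Finset.sum_congr rfl fun v _ => Finset.sum_congr rfl fun u _ => h v u
  linarith

lemma massOf_eq_sum {V : Finset (Pt m)} {a : Pt m →₀ ℝ} (h : ∀ z, a z ≠ 0 → z ∈ V) :
    massOf a = ∑ z ∈ V, a z :=
  Finsupp.sum_of_support_subset a (fun z hz => h z (Finsupp.mem_support_iff.1 hz)) _
    (fun _ _ => rfl)

lemma IsFlow.massOf_eq {V : Finset (Pt m)} {f : Pt m → Pt m → ℝ} {a b : Pt m →₀ ℝ}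
    (h : IsFlow V f a b) : massOf a = massOf b := by
  rw [massOf_eq_sum h.source_mem, massOf_eq_sum h.sink_mem]
  have h1 := sum_antisymm_eq_zero (K := V) h.anti
  simp only [h.div, Finset.sum_sub_distrib] at h1
  linarith

/-- The unit flow along the edge from `u` to `w`. -/
def edgeFlow (u w p q : Pt m) : ℝ :=
  (if p = u ∧ q = w then 1 else 0) - (if p = w ∧ q = u then 1 else 0)

lemma edgeFlow_anti (u w p q : Pt m) : edgeFlow u w q p = -edgeFlow u w p q := by
  unfold edgeFlow
  simp only [and_comm (a := q = u), and_comm (a := q = w)]; ring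

lemma edgeFlow_ne_zero {u w p q : Pt m} (h : edgeFlow u w p q ≠ 0) :
    (p = u ∧ q = w) ∨ (p = w ∧ q = u) := by
  by_contra hcon
  push Not at hcon
  apply h
  unfold edgeFlow
  rw [if_neg (by tauto), if_neg (by tauto)]; simp

lemma edgeFlow_div {V : Finset (Pt m)} {u w : Pt m} (hu : u ∈ V) (hw : w ∈ V) (z : Pt m) :
    ∑ q ∈ V, edgeFlow u w z q = Finsupp.single u (1 : ℝ) z - Finsupp.single w (1 : ℝ) z := by
  unfold edgeFlow
  rw [Finset.sum_sub_distrib]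
  simp only [ite_and, Finsupp.single_apply]
  congr 1
  · by_cases h : z = u
    · simp [h, hw]
    · simp [h, Ne.symm h]
  · by_cases h : z = w
    · simp [h, hu]
    · simp [h, Ne.symm h]

/-- Connected vertices carry a unit flow supported on the graph. -/
lemma exists_unit_flow {H : SimpleGraph (Pt m)} {V : Finset (Pt m)}
    (hV : ∀ u v, H.Adj u v → u ∈ V) {u v : Pt m} (h : H.Reachable u v) :
    ∃ χ : Pt m → Pt m → ℝ, (∀ p q, χ q p = -χ p q) ∧ (∀ p q, χ p q ≠ 0 → H.Adj p q) ∧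
      ∀ z, ∑ q ∈ V, χ z q = Finsupp.single u (1 : ℝ) z - Finsupp.single v (1 : ℝ) z := by
  obtain ⟨p⟩ := h
  induction p with
  | nil => exact ⟨fun _ _ => 0, by simp, by simp, by simp⟩
  | @cons u w v hadj p ih =>
    obtain ⟨χ, h1, h2, h3⟩ := ih
    refine ⟨fun p q => edgeFlow u w p q + χ p q, ?_, ?_, ?_⟩
    · intro p q
      beta_reduce
      rw [h1, edgeFlow_anti u w p q]; ring
    · intro p q hpq
      by_cases h : χ p q = 0
      · simp only [h, add_zero] at hpq
        rcases edgeFlow_ne_zero hpq with ⟨rfl, rfl⟩ | ⟨rfl, rfl⟩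
        · exact hadj
        · exact hadj.symm
      · exact h2 p q h
    · intro z
      rw [Finset.sum_add_distrib, h3, edgeFlow_div (hV _ _ hadj) (hV _ _ hadj.symm)]
      ring

/-- Perturbing a flow along a direction supported on it. -/
lemma IsFlow.exists_step {V : Finset (Pt m)} {f : Pt m → Pt m → ℝ} {a b : Pt m →₀ ℝ}
    (h : IsFlow V f a b) {α : ℝ} (hα : 0 ≤ α) (hα1 : α < 1) {χ : Pt m → Pt m → ℝ} {β : Pt m →₀ ℝ}
    (hanti : ∀ u v, χ v u = -χ u v) (hsupp : ∀ u v, χ u v ≠ 0 → f u v ≠ 0)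
    (hdiv : ∀ v, ∑ u ∈ V, χ v u = β v) (hβ : ∀ z, β z ≠ 0 → a z ≠ 0)
    (hne : ∃ u v, χ u v ≠ 0) :
    ∃ (f' : Pt m → Pt m → ℝ) (a' : Pt m →₀ ℝ), IsFlow V f' a' b ∧
      (∀ z, a' z ≠ 0 → a z ≠ 0) ∧
      ((V ×ˢ V).filter fun p => f' p.1 p.2 ≠ 0).card + a'.support.card <
        ((V ×ˢ V).filter fun p => f p.1 p.2 ≠ 0).card + a.support.card ∧
      flowCost α V f' ≤ flowCost α V f ∧
      (0 < α → flowCost α V f' < flowCost α V f) := by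
  obtain ⟨u₀, v₀, hne⟩ := hne
  let s : Finset ((Pt m × Pt m) ⊕ Pt m) := (V ×ˢ V).disjSum V
  let F : (Pt m × Pt m) ⊕ Pt m → ℝ := Sum.elim (fun p => f p.1 p.2) a
  let X : (Pt m × Pt m) ⊕ Pt m → ℝ := Sum.elim (fun p => χ p.1 p.2) β
  let c : (Pt m × Pt m) ⊕ Pt m → ℝ := Sum.elim (fun p => dist p.1 p.2) fun _ => 0
  have hmemV : ∀ u v, f u v ≠ 0 → (u, v) ∈ V ×ˢ V := fun u v huv =>
    Finset.mem_product.2 ⟨h.mem u v huv, h.mem_right u v huv⟩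
  obtain ⟨t, hsign, hzero, hle, hlt⟩ := exists_shift s hα hα1 c F X
    (by rintro (p | z) _ <;> simp [c]) (by
      rintro (p | z) _ hX
      · exact hsupp _ _ hX
      · exact hβ _ hX)
    ⟨Sum.inl (u₀, v₀), by simpa [s] using hmemV _ _ (hsupp _ _ hne), hne⟩
  have hf_sub : ∀ u v, f u v + t * χ u v ≠ 0 → f u v ≠ 0 := by
    intro u v huv hf
    have : χ u v = 0 := by
      by_contra hcon; exact hsupp u v hcon hf
    simp [hf, this] at huv
  have ha_sub : ∀ z, (a + t • β) z ≠ 0 → a z ≠ 0 := by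
    intro z hz hf
    have : β z = 0 := by
      by_contra hcon; exact hβ z hcon hf
    simp [hf, this] at hz
  refine ⟨fun u v => f u v + t * χ u v, a + t • β, ⟨?_, ?_, ?_, ?_, ?_, h.sink_mem⟩, ha_sub,
    ?_, ?_, ?_⟩
  · intro u v
    rw [h.anti u v, hanti u v]; ring
  · exact fun u v huv => h.mem u v (hf_sub u v huv)
  · intro v
    rw [Finset.sum_add_distrib, ← Finset.mul_sum, h.div, hdiv]
    simp; ring
  · intro z
    by_cases hz : a z = 0
    · by_contra hcon
      exact ha_sub z (ne_of_lt (not_le.1 hcon)) hz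
    · have h1 := hsign (Sum.inr z) (by simpa [s] using h.source_mem z hz)
      exact nonneg_of_mul_nonneg_right h1 (lt_of_le_of_ne (h.nonneg z) (Ne.symm hz))
  · exact fun z hz => h.source_mem z (ha_sub z hz)
  · have hE : ((V ×ˢ V).filter fun p => f p.1 p.2 + t * χ p.1 p.2 ≠ 0) ⊆
        (V ×ˢ V).filter fun p => f p.1 p.2 ≠ 0 := by
      intro p hp
      rw [Finset.mem_filter] at hp ⊢
      exact ⟨hp.1, hf_sub _ _ hp.2⟩
    have hS : (a + t • β).support ⊆ a.support := by
      intro z hz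
      rw [Finsupp.mem_support_iff] at hz ⊢
      exact ha_sub z hz
    obtain ⟨i, hi, hF, hFX⟩ := hzero
    rcases i with p | z
    · refine add_lt_add_of_lt_of_le (Finset.card_lt_card ?_) (Finset.card_le_card hS)
      refine (Finset.ssubset_iff_of_subset hE).2 ⟨p, ?_, ?_⟩
      · rw [Finset.mem_filter]
        exact ⟨hmemV _ _ hF, hF⟩
      · rw [Finset.mem_filter]
        exact fun hp => hp.2 hFX
    · refine add_lt_add_of_le_of_lt (Finset.card_le_card hE) (Finset.card_lt_card ?_)
      refine (Finset.ssubset_iff_of_subset hS).2 ⟨z, Finsupp.mem_support_iff.2 hF, ?_⟩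
      rw [Finsupp.mem_support_iff, not_not]
      exact hFX
  · simpa [s, Finset.sum_disjSum, flowCost, c, F, X] using hle
  · intro hα'
    have hcost := hlt hα' ?_
    · simpa [s, Finset.sum_disjSum, flowCost, c, F, X] using hcost
    have hd : ∀ u v, f u v ≠ 0 → 0 < dist u v := fun u v huv => by
      rw [dist_pos]; rintro rfl; exact huv (antisymm_self h.anti u)
    have hf := hsupp _ _ hne
    rcases lt_or_gt_of_ne hf with h1 | h1
    · have h2 : 0 < f v₀ u₀ := by rw [h.anti u₀ v₀]; linarith
      exact ⟨Sum.inl (v₀, u₀), by simpa [s] using hmemV _ _ h2.ne', h2, by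
        change χ v₀ u₀ ≠ 0
        rw [hanti u₀ v₀]; simpa using hne, hd _ _ h2.ne'⟩
    · exact ⟨Sum.inl (u₀, v₀), by simpa [s] using hmemV _ _ h1.ne', h1, hne, hd _ _ h1.ne'⟩

/-- No two distinct sources of `a` lie in the same component of `H`. -/
def SeparatesSources (H : SimpleGraph (Pt m)) (a : Pt m →₀ ℝ) : Prop :=
  ∀ p q, a p ≠ 0 → a q ≠ 0 → H.Reachable p q → p = q

/-- A direction along which a flow with a cycle can be shifted. -/
lemma IsFlow.exists_direction_of_not_isAcyclic {V : Finset (Pt m)} {f : Pt m → Pt m → ℝ}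
    {a b : Pt m →₀ ℝ} (h : IsFlow V f a b) (hcyc : ¬ (flowGraph f).IsAcyclic) :
    ∃ χ : Pt m → Pt m → ℝ, (∀ u v, χ v u = -χ u v) ∧ (∀ u v, χ u v ≠ 0 → f u v ≠ 0) ∧
      (∀ v, ∑ u ∈ V, χ v u = 0) ∧ ∃ u v, χ u v ≠ 0 := by
  rw [SimpleGraph.isAcyclic_iff_forall_adj_isBridge] at hcyc
  push Not at hcyc
  obtain ⟨u, v, hadj, hbr⟩ := hcyc
  rw [SimpleGraph.isBridge_iff, not_not] at hbr
  have huv := (flowGraph_adj h.anti u v).1 hadj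
  obtain ⟨χ, h1, h2, h3⟩ := exists_unit_flow (V := V) (fun p q hpq => h.mem p q
    ((flowGraph_adj h.anti p q).1 (SimpleGraph.deleteEdges_le _ hpq))) hbr.symm
  have h0 : χ u v = 0 := by
    by_contra hcon
    have := h2 u v hcon
    simp at this
  refine ⟨fun p q => edgeFlow u v p q + χ p q, ?_, ?_, ?_, u, v, ?_⟩
  · intro p q
    beta_reduce
    rw [h1, edgeFlow_anti u v p q]; ring
  · intro p q hpq
    rw [← flowGraph_adj h.anti]
    by_cases hχ : χ p q = 0
    · simp only [hχ, add_zero] at hpq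
      rcases edgeFlow_ne_zero hpq with ⟨rfl, rfl⟩ | ⟨rfl, rfl⟩
      · exact hadj
      · exact hadj.symm
    · exact SimpleGraph.deleteEdges_le _ (h2 p q hχ)
  · intro z
    rw [Finset.sum_add_distrib, h3, edgeFlow_div (h.mem _ _ huv) (h.mem_right _ _ huv)]
    ring
  · have hne := hadj.ne
    simp [h0, edgeFlow, hne]

/-- A direction along which mass can be transferred between two connected sources. -/
lemma IsFlow.exists_direction_of_reachable {V : Finset (Pt m)} {f : Pt m → Pt m → ℝ}
    {a b : Pt m →₀ ℝ} (h : IsFlow V f a b) {p q : Pt m} (hpq : p ≠ q)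
    (hr : (flowGraph f).Reachable p q) :
    ∃ χ : Pt m → Pt m → ℝ, (∀ u v, χ v u = -χ u v) ∧ (∀ u v, χ u v ≠ 0 → f u v ≠ 0) ∧
      (∀ v, ∑ u ∈ V, χ v u = (Finsupp.single p 1 - Finsupp.single q 1 : Pt m →₀ ℝ) v) ∧
      ∃ u v, χ u v ≠ 0 := by
  obtain ⟨χ, h1, h2, h3⟩ := exists_unit_flow (V := V) (fun u v huv => h.mem u v
    ((flowGraph_adj h.anti u v).1 huv)) hr
  refine ⟨χ, h1, fun u v huv => (flowGraph_adj h.anti u v).1 (h2 u v huv), fun v => by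
    simp [h3], p, ?_⟩
  by_contra hcon
  push Not at hcon
  have := h3 p
  simp [hcon, hpq] at this

/-- Every flow can be reduced, without increasing its cost or adding sources, to one whose support
is a forest in which no two sources are connected. -/
lemma IsFlow.exists_reduced {V : Finset (Pt m)} {b : Pt m →₀ ℝ} {α : ℝ} (hα : 0 ≤ α)
    (hα1 : α < 1) {f : Pt m → Pt m → ℝ} {a : Pt m →₀ ℝ} (h : IsFlow V f a b) :
    ∃ (f' : Pt m → Pt m → ℝ) (a' : Pt m →₀ ℝ), IsFlow V f' a' b ∧
      (∀ z, a' z ≠ 0 → a z ≠ 0) ∧ flowCost α V f' ≤ flowCost α V f ∧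
      (flowGraph f').IsAcyclic ∧ SeparatesSources (flowGraph f') a' := by
  induction hN : ((V ×ˢ V).filter fun p => f p.1 p.2 ≠ 0).card + a.support.card using
    Nat.strong_induction_on generalizing f a with
  | _ N ih =>
    subst hN
    suffices hstep : ¬ ((flowGraph f).IsAcyclic ∧ SeparatesSources (flowGraph f) a) →
        ∃ (χ : Pt m → Pt m → ℝ) (β : Pt m →₀ ℝ), (∀ u v, χ v u = -χ u v) ∧
          (∀ u v, χ u v ≠ 0 → f u v ≠ 0) ∧ (∀ v, ∑ u ∈ V, χ v u = β v) ∧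
          (∀ z, β z ≠ 0 → a z ≠ 0) ∧ ∃ u v, χ u v ≠ 0 by
      by_cases hgood : (flowGraph f).IsAcyclic ∧ SeparatesSources (flowGraph f) a
      · exact ⟨f, a, h, fun _ => id, le_rfl, hgood⟩
      · obtain ⟨χ, β, h1, h2, h3, h4, h5⟩ := hstep hgood
        obtain ⟨f₁, a₁, k1, k2, k3, k4, -⟩ := h.exists_step hα hα1 h1 h2 h3 h4 h5
        obtain ⟨f', a', l1, l2, l3, l4⟩ := ih _ k3 k1 rfl
        exact ⟨f', a', l1, fun z hz => k2 z (l2 z hz), l3.trans k4, l4⟩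
    intro hbad
    by_cases hcyc : (flowGraph f).IsAcyclic
    · have hs : ¬ SeparatesSources (flowGraph f) a := fun hs => hbad ⟨hcyc, hs⟩
      unfold SeparatesSources at hs
      push Not at hs
      obtain ⟨p, q, hp, hq, hr, hpq⟩ := hs
      obtain ⟨χ, h1, h2, h3, h4⟩ := h.exists_direction_of_reachable hpq hr
      refine ⟨χ, _, h1, h2, h3, ?_, h4⟩
      intro z hz
      by_cases hzp : z = p
      · exact hzp ▸ hp
      by_cases hzq : z = q
      · exact hzq ▸ hq
      simp [Ne.symm hzp, Ne.symm hzq] at hz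
    · obtain ⟨χ, h1, h2, h3, h4⟩ := h.exists_direction_of_not_isAcyclic hcyc
      exact ⟨χ, 0, h1, h2, by simpa using h3, by simp, h4⟩

/-- The net supply of a flow over a union of components vanishes. -/
lemma IsFlow.sum_closed {V : Finset (Pt m)} {f : Pt m → Pt m → ℝ} {a b : Pt m →₀ ℝ}
    (h : IsFlow V f a b) {K : Pt m → Prop} (hK : ∀ u v, f u v ≠ 0 → K u → K v) :
    ∑ z ∈ V.filter K, a z = ∑ z ∈ V.filter K, b z := by
  have h1 : ∑ v ∈ V.filter K, ∑ u ∈ V.filter K, f v u = ∑ v ∈ V.filter K, (a v - b v) := by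
    refine Finset.sum_congr rfl fun v hv => ?_
    rw [← h.div v, Finset.sum_filter]
    refine Finset.sum_congr rfl fun u _ => ?_
    split_ifs with hu
    · rfl
    · by_contra hcon
      exact hu (hK v u (Ne.symm hcon) (Finset.mem_filter.1 hv).2)
  rw [sum_antisymm_eq_zero h.anti, Finset.sum_sub_distrib] at h1
  linarith

/-- Every sink of a flow is connected to some source. -/
lemma IsFlow.exists_source {V : Finset (Pt m)} {f : Pt m → Pt m → ℝ} {a b : Pt m →₀ ℝ}
    (h : IsFlow V f a b) (hb : ∀ z, 0 ≤ b z) {z : Pt m} (hz : b z ≠ 0) :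
    ∃ p, a p ≠ 0 ∧ (flowGraph f).Reachable p z := by
  by_contra hcon
  push Not at hcon
  have h1 := h.sum_closed (K := fun v => (flowGraph f).Reachable v z) (by
    intro u v huv hu
    exact ((flowGraph_adj h.anti u v).2 huv).symm.reachable.trans hu)
  rw [Finset.sum_eq_zero] at h1
  · have h2 := (Finset.sum_eq_zero_iff_of_nonneg (fun v _ => hb v)).1 h1.symm z (by
      rw [Finset.mem_filter]
      exact ⟨h.sink_mem z hz, SimpleGraph.Reachable.refl z⟩)
    exact hz h2
  · intro v hv
    by_contra ha
    exact hcon v ha (Finset.mem_filter.1 hv).2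

lemma two_mul_flowCost_zero {V : Finset (Pt m)} {f : Pt m → Pt m → ℝ}
    (hanti : ∀ u v, f v u = -f u v) :
    2 * flowCost 0 V f = ∑ p ∈ V ×ˢ V, dist p.1 p.2 * (if f p.1 p.2 ≠ 0 then 1 else 0) := by
  have hswap : flowCost 0 V f = ∑ p ∈ V ×ˢ V, dist p.1 p.2 * posRpow 0 (f p.2 p.1) := by
    unfold flowCost
    rw [Finset.sum_product, Finset.sum_product_right]
    exact Finset.sum_congr rfl fun u _ => Finset.sum_congr rfl fun v _ => by rw [dist_comm]
  rw [two_mul]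
  nth_rewrite 2 [hswap]
  unfold flowCost
  rw [← Finset.sum_add_distrib]
  refine Finset.sum_congr rfl fun p _ => ?_
  rw [← mul_add, hanti p.1 p.2]
  congr 1
  rcases lt_trichotomy (f p.1 p.2) 0 with h | h | h
  · simp [posRpow, h, h.ne, h.le.not_gt]
  · simp [posRpow, h]
  · simp [posRpow, h, h.ne', h.le.not_gt]

/-- If two sources are connected, then rerouting all mass so as to avoid one edge between them
is strictly cheaper for the cost exponent `0`. -/
lemma IsFlow.exists_lt_of_reachable_sources {V : Finset (Pt m)} {f : Pt m → Pt m → ℝ}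
    {a b : Pt m →₀ ℝ} (h : IsFlow V f a b) (hb : ∀ z, 0 ≤ b z) {p q : Pt m} (hpq : p ≠ q)
    (hp : a p ≠ 0) (hq : a q ≠ 0) (hr : (flowGraph f).Reachable p q) :
    ∃ (f' : Pt m → Pt m → ℝ) (a' : Pt m →₀ ℝ), IsFlow V f' a' b ∧
      (∀ z, a' z ≠ 0 → a z ≠ 0) ∧ flowCost 0 V f' < flowCost 0 V f := by
  obtain ⟨w, hadj, hwq⟩ : ∃ w, (flowGraph f).Adj p w ∧
      ((flowGraph f).deleteEdges {s(p, w)}).Reachable w q := by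
    obtain ⟨P, hP⟩ := hr.exists_isPath
    cases P with
    | nil => exact absurd rfl hpq
    | @cons _ w _ hadj P =>
      refine ⟨w, hadj, SimpleGraph.reachable_deleteEdges_iff_exists_walk.2 ⟨P, fun hmem => ?_⟩⟩
      rw [SimpleGraph.Walk.cons_isPath_iff] at hP
      exact hP.2 (P.fst_mem_support_of_mem_edges hmem)
  set H := (flowGraph f).deleteEdges {s(p, w)} with hH
  have hHadj : ∀ u v, H.Adj u v → f u v ≠ 0 := fun u v huv =>
    (flowGraph_adj h.anti u v).1 (SimpleGraph.deleteEdges_le _ huv)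
  have hreach : ∀ s z, (flowGraph f).Reachable s z → a s ≠ 0 →
      ∃ s', a s' ≠ 0 ∧ H.Reachable s' z := by
    rintro s z ⟨P⟩ hs
    have : ∀ u v, (flowGraph f).Walk u v → (∃ s', a s' ≠ 0 ∧ H.Reachable s' u) →
        ∃ s', a s' ≠ 0 ∧ H.Reachable s' v := by
      intro u v P
      induction P with
      | nil => exact id
      | @cons u u' v huu' _ ih =>
        rintro ⟨s', hs', hsu⟩
        apply ih
        by_cases he : s(u, u') = s(p, w)
        · rcases Sym2.eq_iff.1 he with ⟨-, h2⟩ | ⟨-, h2⟩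
          · exact ⟨q, hq, h2 ▸ hwq.symm⟩
          · exact ⟨p, hp, by rw [h2]⟩
        · have : H.Adj u u' := by
            rw [hH, SimpleGraph.deleteEdges_adj]
            exact ⟨huu', by simpa using he⟩
          exact ⟨s', hs', hsu.trans this.reachable⟩
    exact this s z P ⟨s, hs, SimpleGraph.Reachable.refl s⟩
  have hroute : ∀ z, b z ≠ 0 → ∃ (s : Pt m) (χ : Pt m → Pt m → ℝ), a s ≠ 0 ∧
      (∀ p q, χ q p = -χ p q) ∧ (∀ p q, χ p q ≠ 0 → H.Adj p q) ∧
      ∀ v, ∑ q ∈ V, χ v q = Finsupp.single s (1 : ℝ) v - Finsupp.single z (1 : ℝ) v := by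
    intro z hz
    obtain ⟨s, hs, hsz⟩ := h.exists_source hb hz
    obtain ⟨s', hs', hsz'⟩ := hreach s z hsz hs
    obtain ⟨χ, h1, h2, h3⟩ := exists_unit_flow (V := V)
      (fun u v huv => h.mem u v (hHadj u v huv)) hsz'
    exact ⟨s', χ, hs', h1, h2, h3⟩
  choose! s χ hs hχ1 hχ2 hχ3 using hroute
  have hbs : ∀ z ∈ b.support, b z ≠ 0 := fun z hz => Finsupp.mem_support_iff.1 hz
  have hf' : ∀ u v, ∑ z ∈ b.support, b z * χ z u v ≠ 0 → H.Adj u v := by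
    intro u v huv
    obtain ⟨z, hz, hne⟩ := Finset.exists_ne_zero_of_sum_ne_zero huv
    exact hχ2 z (hbs z hz) u v (right_ne_zero_of_mul hne)
  have ha' : ∀ z, (∑ y ∈ b.support, Finsupp.single (s y) (b y)) z ≠ 0 → a z ≠ 0 := by
    intro z hz
    rw [Finsupp.finsetSum_apply] at hz
    obtain ⟨y, hy, hne⟩ := Finset.exists_ne_zero_of_sum_ne_zero hz
    rw [Finsupp.single_apply] at hne
    split_ifs at hne with hsy
    · exact hsy ▸ hs y (hbs y hy)
    · exact absurd rfl hne
  have hanti' : ∀ u v, ∑ z ∈ b.support, b z * χ z v u = -∑ z ∈ b.support, b z * χ z u v := by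
    intro u v
    rw [← Finset.sum_neg_distrib]
    exact Finset.sum_congr rfl fun z hz => by rw [hχ1 z (hbs z hz) u v]; ring
  refine ⟨fun u v => ∑ z ∈ b.support, b z * χ z u v,
    ∑ y ∈ b.support, Finsupp.single (s y) (b y), ⟨hanti', ?_, ?_, ?_, ?_, h.sink_mem⟩, ha', ?_⟩
  · exact fun u v huv => h.mem u v (hHadj u v (hf' u v huv))
  · intro v
    have hbv : b v = ∑ z ∈ b.support, b z * Finsupp.single z (1 : ℝ) v := by
      simp only [Finsupp.single_apply, mul_ite, mul_one, mul_zero, Finset.sum_ite_eq',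
        Finsupp.mem_support_iff]
      split_ifs with h0
      · rfl
      · simpa using h0
    rw [Finset.sum_comm, Finsupp.finsetSum_apply, hbv, ← Finset.sum_sub_distrib]
    refine Finset.sum_congr rfl fun z hz => ?_
    rw [← Finset.mul_sum, hχ3 z (hbs z hz), mul_sub]
    congr 1
    simp [Finsupp.single_apply]
  · intro z
    rw [Finsupp.finsetSum_apply]
    refine Finset.sum_nonneg fun y _ => ?_
    rw [Finsupp.single_apply]
    split_ifs
    · exact hb y
    · exact le_rfl
  · exact fun z hz => h.source_mem z (ha' z hz)
  · suffices h2 : 2 * flowCost 0 V (fun u v => ∑ z ∈ b.support, b z * χ z u v) <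
        2 * flowCost 0 V f by linarith
    rw [two_mul_flowCost_zero hanti', two_mul_flowCost_zero h.anti]
    have hfpw := (flowGraph_adj h.anti p w).1 hadj
    refine Finset.sum_lt_sum (fun e _ => ?_) ⟨(p, w), Finset.mem_product.2
      ⟨h.mem _ _ hfpw, h.mem_right _ _ hfpw⟩, ?_⟩
    · refine mul_le_mul_of_nonneg_left ?_ dist_nonneg
      split_ifs with h1 h2 h2
      · exact le_rfl
      · exact absurd (hHadj _ _ (hf' _ _ h1)) h2
      · exact zero_le_one
      · exact le_rfl
    · have h0 : ∑ z ∈ b.support, b z * χ z p w = 0 := by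
        by_contra hcon
        have := hf' p w hcon
        simp [hH] at this
      have hd : 0 < dist p w := dist_pos.2 hadj.ne
      rw [if_neg (not_not.2 h0), if_pos hfpw]
      simpa using hadj.ne

/-- If two sources are connected, the flow is not of minimal cost. -/
lemma IsFlow.exists_lt_of_not_separatesSources {V : Finset (Pt m)} {f : Pt m → Pt m → ℝ}
    {a b : Pt m →₀ ℝ} (h : IsFlow V f a b) {α : ℝ} (hα : 0 ≤ α) (hα1 : α < 1)
    (hb : ∀ z, 0 ≤ b z) (hs : ¬ SeparatesSources (flowGraph f) a) :
    ∃ (f' : Pt m → Pt m → ℝ) (a' : Pt m →₀ ℝ), IsFlow V f' a' b ∧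
      (∀ z, a' z ≠ 0 → a z ≠ 0) ∧ flowCost α V f' < flowCost α V f := by
  unfold SeparatesSources at hs
  push Not at hs
  obtain ⟨p, q, hp, hq, hr, hpq⟩ := hs
  rcases hα.eq_or_lt with rfl | hα'
  · exact h.exists_lt_of_reachable_sources hb hpq hp hq hr
  · obtain ⟨χ, h1, h2, h3, h4⟩ := h.exists_direction_of_reachable hpq hr
    obtain ⟨f', a', k1, k2, -, -, k3⟩ := h.exists_step hα hα1 h1 h2 h3 (by
      intro z hz
      by_cases hzp : z = p
      · exact hzp ▸ hp
      by_cases hzq : z = q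
      · exact hzq ▸ hq
      simp [Ne.symm hzp, Ne.symm hzq] at hz) h4
    exact ⟨f', a', k1, k2, k3 hα'⟩

end Flow

namespace WDG

variable {m : ℕ}

/-- The antisymmetric flow carried by a weighted directed graph. -/
def toFlow (G : WDG m) (u v : Pt m) : ℝ :=
  (if (u, v) ∈ G.E then G.w (u, v) else 0) - (if (v, u) ∈ G.E then G.w (v, u) else 0)

/-- The weighted directed graph of the positive part of a flow. -/
def ofFlow (V : Finset (Pt m)) (f : Pt m → Pt m → ℝ) : WDG m :=
  ⟨V, (V ×ˢ V).filter fun p => 0 < f p.1 p.2, fun p => f p.1 p.2⟩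

/-- The part of a graph with vertices satisfying `K`. -/
def restrict (G : WDG m) (K : Pt m → Prop) : WDG m :=
  ⟨G.V.filter K, G.E.filter fun e => K e.1, G.w⟩

lemma toFlow_anti (G : WDG m) (u v : Pt m) : G.toFlow v u = -G.toFlow u v := by
  unfold toFlow; ring

lemma toFlow_ne_zero {G : WDG m} {u v : Pt m} (h : G.toFlow u v ≠ 0) :
    (u, v) ∈ G.E ∨ (v, u) ∈ G.E := by
  by_contra hcon
  push Not at hcon
  exact h (by simp [toFlow, hcon])

lemma undirected_adj {G : WDG m} (hG : G.edgesOK) (u v : Pt m) :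
    G.undirected.Adj u v ↔ (u, v) ∈ G.E ∨ (v, u) ∈ G.E := by
  rw [undirected, SimpleGraph.fromRel_adj]
  refine ⟨And.right, fun h => ⟨?_, h⟩⟩
  rintro rfl
  exact (hG (u, u) (by simpa using h)).2.2.1 rfl

lemma flowGraph_toFlow_le {G : WDG m} (hG : G.edgesOK) : flowGraph G.toFlow ≤ G.undirected :=
  fun u v h => (undirected_adj hG u v).2 (toFlow_ne_zero ((flowGraph_adj G.toFlow_anti u v).1 h))

lemma outflow_eq {G : WDG m} (hG : G.edgesOK) {V : Finset (Pt m)} (hV : G.V ⊆ V) (v : Pt m) :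
    G.outflow v = ∑ u ∈ V, if (v, u) ∈ G.E then G.w (v, u) else 0 := by
  rw [outflow, ← Finset.sum_filter]
  refine Finset.sum_nbij' (fun e => e.2) (fun u => (v, u)) ?_ ?_ ?_ ?_ ?_
  · rintro ⟨p, q⟩ he
    simp only [Finset.mem_filter] at he ⊢
    obtain ⟨he, rfl⟩ := he
    exact ⟨hV (hG _ he).2.1, he⟩
  · intro u hu
    simpa using (Finset.mem_filter.1 hu).2
  · rintro ⟨p, q⟩ he
    simp only [Finset.mem_filter] at he
    rw [he.2]
  · intro u _; rfl
  · rintro ⟨p, q⟩ he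
    simp only [Finset.mem_filter] at he
    rw [he.2]

lemma inflow_eq {G : WDG m} (hG : G.edgesOK) {V : Finset (Pt m)} (hV : G.V ⊆ V) (v : Pt m) :
    G.inflow v = ∑ u ∈ V, if (u, v) ∈ G.E then G.w (u, v) else 0 := by
  rw [inflow, ← Finset.sum_filter]
  refine Finset.sum_nbij' (fun e => e.1) (fun u => (u, v)) ?_ ?_ ?_ ?_ ?_
  · rintro ⟨p, q⟩ he
    simp only [Finset.mem_filter] at he ⊢
    obtain ⟨he, rfl⟩ := he
    exact ⟨hV (hG _ he).1, he⟩
  · intro u hu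
    simpa using (Finset.mem_filter.1 hu).2
  · rintro ⟨p, q⟩ he
    simp only [Finset.mem_filter] at he
    rw [he.2]
  · intro u _; rfl
  · rintro ⟨p, q⟩ he
    simp only [Finset.mem_filter] at he
    rw [he.2]

lemma sum_toFlow {G : WDG m} (hG : G.edgesOK) {V : Finset (Pt m)} (hV : G.V ⊆ V) (v : Pt m) :
    ∑ u ∈ V, G.toFlow v u = G.outflow v - G.inflow v := by
  rw [outflow_eq hG hV, inflow_eq hG hV, ← Finset.sum_sub_distrib]
  rfl

lemma edge_mem_product {G : WDG m} (hG : G.edgesOK) {V : Finset (Pt m)} (hV : G.V ⊆ V) :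
    G.E ⊆ V ×ˢ V := fun e he => Finset.mem_product.2 ⟨hV (hG e he).1, hV (hG e he).2.1⟩

lemma cost_eq_sum {G : WDG m} (hG : G.edgesOK) {V : Finset (Pt m)} (hV : G.V ⊆ V) (α : ℝ) :
    G.cost α = ∑ e ∈ V ×ˢ V, if e ∈ G.E then G.w e ^ α * dist e.1 e.2 else 0 := by
  rw [Finset.sum_ite_mem, Finset.inter_eq_right.2 (edge_mem_product hG hV), cost]

lemma posRpow_toFlow_le {G : WDG m} (hG : G.edgesOK) {α : ℝ} (hα : 0 ≤ α) (e : Pt m × Pt m) :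
    dist e.1 e.2 * posRpow α (G.toFlow e.1 e.2) ≤
      if e ∈ G.E then G.w e ^ α * dist e.1 e.2 else 0 := by
  obtain ⟨u, v⟩ := e
  have h2 : 0 ≤ if (v, u) ∈ G.E then G.w (v, u) else 0 := by
    split_ifs with h
    · exact (hG _ h).2.2.2.le
    · exact le_rfl
  simp only
  split_ifs with h
  · have h1 : G.toFlow u v ≤ G.w (u, v) := by
      unfold toFlow; rw [if_pos h]; linarith
    have h3 := posRpow_mono hα h1
    rw [posRpow_of_pos α (hG _ h).2.2.2] at h3
    rw [mul_comm]
    exact mul_le_mul_of_nonneg_right h3 dist_nonneg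
  · rw [posRpow_of_nonpos, mul_zero]
    unfold toFlow; rw [if_neg h]; linarith

lemma flowCost_toFlow_le {G : WDG m} (hG : G.edgesOK) {V : Finset (Pt m)} (hV : G.V ⊆ V) {α : ℝ}
    (hα : 0 ≤ α) : flowCost α V G.toFlow ≤ G.cost α := by
  rw [cost_eq_sum hG hV]
  exact Finset.sum_le_sum fun e _ => posRpow_toFlow_le hG hα e

lemma edge_cost_pos {G : WDG m} (hG : G.edgesOK) (α : ℝ) {e : Pt m × Pt m} (he : e ∈ G.E) :
    0 < G.w e ^ α * dist e.1 e.2 :=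
  mul_pos (Real.rpow_pos_of_pos (hG e he).2.2.2 α) (dist_pos.2 (hG e he).2.2.1)

lemma cost_nonneg {G : WDG m} (hG : G.edgesOK) (α : ℝ) : 0 ≤ G.cost α :=
  Finset.sum_nonneg fun _ he => (edge_cost_pos hG α he).le

/-- Antiparallel edges make the associated flow strictly cheaper than the graph. -/
lemma flowCost_toFlow_lt {G : WDG m} (hG : G.edgesOK) {V : Finset (Pt m)} (hV : G.V ⊆ V) {α : ℝ}
    (hα : 0 ≤ α) {u v : Pt m} (huv : (u, v) ∈ G.E) (hvu : (v, u) ∈ G.E) :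
    flowCost α V G.toFlow < G.cost α := by
  wlog hle : G.w (u, v) ≤ G.w (v, u) generalizing u v
  · exact this hvu huv (le_of_not_ge hle)
  rw [cost_eq_sum hG hV]
  refine Finset.sum_lt_sum (fun e _ => posRpow_toFlow_le hG hα e)
    ⟨(u, v), edge_mem_product hG hV huv, ?_⟩
  have h0 : G.toFlow u v ≤ 0 := by
    unfold toFlow; rw [if_pos huv, if_pos hvu]; linarith
  rw [if_pos huv, posRpow_of_nonpos α h0, mul_zero]
  exact edge_cost_pos hG α huv

lemma undirected_le_flowGraph {G : WDG m} (hG : G.edgesOK) {V : Finset (Pt m)} (hV : G.V ⊆ V)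
    {α : ℝ} (hα : 0 ≤ α) (hcost : G.cost α ≤ flowCost α V G.toFlow) :
    G.undirected ≤ flowGraph G.toFlow := by
  have key : ∀ u v, (u, v) ∈ G.E → (flowGraph G.toFlow).Adj u v := by
    intro u v huv
    have hvu : (v, u) ∉ G.E := fun hvu =>
      absurd (flowCost_toFlow_lt hG hV hα huv hvu) hcost.not_gt
    rw [flowGraph_adj G.toFlow_anti]
    unfold toFlow
    rw [if_pos huv, if_neg hvu, sub_zero]
    exact (hG _ huv).2.2.2.ne'
  intro u v h
  rcases (undirected_adj hG u v).1 h with h | h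
  · exact key u v h
  · exact (key v u h).symm

lemma isFlow_toFlow {X : Set (Pt m)} {G : WDG m} {a b : Pt m →₀ ℝ}
    (h : IsTransportPath X G a b) (ha : ∀ z, 0 ≤ a z) {V : Finset (Pt m)} (hV : G.V ⊆ V) :
    IsFlow V G.toFlow a b where
  anti := G.toFlow_anti
  mem u v huv := by
    rcases toFlow_ne_zero huv with h1 | h1
    · exact hV (h.1 _ h1).1
    · exact hV (h.1 _ h1).2.1
  div v := by rw [sum_toFlow h.1 hV, h.2.2.2.2.2]
  nonneg := ha
  source_mem z hz := hV (h.2.2.1 z (Finsupp.mem_support_iff.2 hz))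
  sink_mem z hz := hV (h.2.2.2.1 z (Finsupp.mem_support_iff.2 hz))

lemma ofFlow_edgesOK {V : Finset (Pt m)} {f : Pt m → Pt m → ℝ} (hf : ∀ u v, f v u = -f u v) :
    (ofFlow V f).edgesOK := by
  intro e he
  simp only [ofFlow, Finset.mem_filter, Finset.mem_product] at he ⊢
  refine ⟨he.1.1, he.1.2, ?_, he.2⟩
  intro h
  rw [h, antisymm_self hf] at he
  exact he.2.false

lemma toFlow_ofFlow {V : Finset (Pt m)} {f : Pt m → Pt m → ℝ} {a b : Pt m →₀ ℝ}
    (h : IsFlow V f a b) (u v : Pt m) : (ofFlow V f).toFlow u v = f u v := by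
  by_cases h0 : f u v = 0
  · have h1 : f v u = 0 := by rw [h.anti u v, h0, neg_zero]
    simp [toFlow, ofFlow, h0, h1]
  · have hu := h.mem u v h0
    have hv := h.mem_right u v h0
    have h1 := h.anti u v
    simp only [toFlow, ofFlow, Finset.mem_filter, Finset.mem_product, hu, hv, true_and]
    rcases lt_or_gt_of_ne h0 with h2 | h2
    · rw [if_neg h2.not_gt, if_pos (by linarith)]; linarith
    · rw [if_pos h2, if_neg (by linarith)]; linarith

lemma undirected_ofFlow_le {V : Finset (Pt m)} {f : Pt m → Pt m → ℝ}
    (hf : ∀ u v, f v u = -f u v) : (ofFlow V f).undirected ≤ flowGraph f := by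
  intro u v h
  rw [flowGraph_adj hf]
  rcases (undirected_adj (ofFlow_edgesOK hf) u v).1 h with h | h
  · exact (Finset.mem_filter.1 h).2.ne'
  · have := (Finset.mem_filter.1 h).2
    rw [hf u v] at this
    simpa using this.ne'

lemma isTransportPath_ofFlow {X : Set (Pt m)} {V : Finset (Pt m)} {f : Pt m → Pt m → ℝ}
    {a b : Pt m →₀ ℝ} (h : IsFlow V f a b) (hV : ↑V ⊆ X) (hac : (flowGraph f).IsAcyclic) :
    IsTransportPath X (ofFlow V f) a b := by
  refine ⟨ofFlow_edgesOK h.anti, hV, fun z hz => h.source_mem z (Finsupp.mem_support_iff.1 hz),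
    fun z hz => h.sink_mem z (Finsupp.mem_support_iff.1 hz),
    hac.anti (undirected_ofFlow_le h.anti), fun v => ?_⟩
  rw [← sum_toFlow (ofFlow_edgesOK h.anti) (V := V) (Finset.Subset.refl V), ← h.div]
  exact Finset.sum_congr rfl fun u _ => toFlow_ofFlow h v u

lemma cost_ofFlow (α : ℝ) (V : Finset (Pt m)) (f : Pt m → Pt m → ℝ) :
    (ofFlow V f).cost α = flowCost α V f := by
  unfold cost ofFlow flowCost
  rw [Finset.sum_filter]
  refine Finset.sum_congr rfl fun e _ => ?_
  unfold posRpow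
  split_ifs <;> ring

lemma restrict_isTransportPath {X : Set (Pt m)} {G : WDG m} {a b a' b' : Pt m →₀ ℝ}
    (h : IsTransportPath X G a b) {K : Pt m → Prop} (hK : ∀ e ∈ G.E, K e.1 ↔ K e.2)
    (ha' : ∀ z, a' z ≠ 0 → a z ≠ 0 ∧ K z) (hb' : ∀ z, b' z ≠ 0 → b z ≠ 0 ∧ K z)
    (hbal : ∀ z, a' z - b' z = if K z then a z - b z else 0) :
    IsTransportPath X (G.restrict K) a' b' := by
  obtain ⟨h1, h2, h3, h4, h5, h6⟩ := h
  have hle : (G.restrict K).undirected ≤ G.undirected := by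
    intro u v huv
    rw [undirected, SimpleGraph.fromRel_adj] at huv ⊢
    exact ⟨huv.1, huv.2.imp (fun h => (Finset.mem_filter.1 h).1)
      fun h => (Finset.mem_filter.1 h).1⟩
  refine ⟨?_, ?_, ?_, ?_, h5.anti hle, ?_⟩
  · intro e he
    obtain ⟨heE, heK⟩ := Finset.mem_filter.1 he
    exact ⟨Finset.mem_filter.2 ⟨(h1 e heE).1, heK⟩,
      Finset.mem_filter.2 ⟨(h1 e heE).2.1, (hK e heE).1 heK⟩, (h1 e heE).2.2⟩
  · intro z hz
    exact h2 (Finset.mem_filter.1 hz).1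
  · intro z hz
    obtain ⟨hz, hzK⟩ := ha' z (Finsupp.mem_support_iff.1 hz)
    exact Finset.mem_filter.2 ⟨h3 z (Finsupp.mem_support_iff.2 hz), hzK⟩
  · intro z hz
    obtain ⟨hz, hzK⟩ := hb' z (Finsupp.mem_support_iff.1 hz)
    exact Finset.mem_filter.2 ⟨h4 z (Finsupp.mem_support_iff.2 hz), hzK⟩
  · intro v
    rw [hbal, ← h6]
    have hout : (G.restrict K).outflow v = if K v then G.outflow v else 0 := by
      unfold outflow restrict
      rw [Finset.filter_filter]
      split_ifs with hv
      · congr 1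
        refine Finset.filter_congr fun e _ => ⟨And.right, fun he => ⟨he ▸ hv, he⟩⟩
      · rw [Finset.filter_false_of_mem, Finset.sum_empty]
        rintro e _ ⟨he, rfl⟩
        exact hv he
    have hin : (G.restrict K).inflow v = if K v then G.inflow v else 0 := by
      unfold inflow restrict
      rw [Finset.filter_filter]
      split_ifs with hv
      · congr 1
        refine Finset.filter_congr fun e heE => ⟨And.right, fun he => ⟨(hK e heE).2 (he ▸ hv), he⟩⟩
      · rw [Finset.filter_false_of_mem, Finset.sum_empty]
        rintro e heE ⟨he, rfl⟩
        exact hv ((hK e heE).1 he)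
    rw [hout, hin]
    split_ifs <;> simp

end WDG

section FilterProp

variable {β : Type*} {s : Finset β} {K : β → Prop}

lemma mem_filter_prop {z : β} : z ∈ s.filter K ↔ z ∈ s ∧ K z :=
  Finset.mem_filter

lemma filter_prop_eq_empty (h : ∀ z ∈ s, ¬ K z) : s.filter K = ∅ :=
  Finset.filter_false_of_mem h

lemma filter_prop_subset (s : Finset β) (K : β → Prop) : s.filter K ⊆ s :=
  Finset.filter_subset _ _

end FilterProp

section Assignment

variable {m k ℓ : ℕ}

lemma bMeas_apply (y : Fin ℓ → Pt m) (n : Fin ℓ → ℝ) (z : Pt m) :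
    bMeas y n z = ∑ j, if y j = z then n j else 0 := by
  simp [bMeas, Finsupp.finsetSum_apply, Finsupp.single_apply]

lemma bPart_apply (y : Fin ℓ → Pt m) (n : Fin ℓ → ℝ) (S : Fin ℓ → Fin k) (i : Fin k) (z : Pt m) :
    bPart y n S i z = ∑ j, if S j = i then if y j = z then n j else 0 else 0 := by
  rw [bPart, Finsupp.finsetSum_apply, Finset.sum_filter]
  simp only [Finsupp.single_apply]

lemma sum_bPart (y : Fin ℓ → Pt m) (n : Fin ℓ → ℝ) (S : Fin ℓ → Fin k) :
    ∑ i, bPart y n S i = bMeas y n :=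
  Finset.sum_fiberwise _ _ _

lemma bMeas_nonneg {y : Fin ℓ → Pt m} {n : Fin ℓ → ℝ} (hn : ∀ j, 0 < n j) (z : Pt m) :
    0 ≤ bMeas y n z := by
  rw [bMeas_apply]
  refine Finset.sum_nonneg fun j _ => ?_
  split_ifs
  · exact (hn j).le
  · exact le_rfl

lemma bMeas_ne_zero {y : Fin ℓ → Pt m} {n : Fin ℓ → ℝ} (hn : ∀ j, 0 < n j) (j : Fin ℓ) :
    bMeas y n (y j) ≠ 0 := by
  rw [bMeas_apply]
  refine (Finset.sum_pos' (fun i _ => ?_) ⟨j, Finset.mem_univ j, by simpa using hn j⟩).ne'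
  split_ifs
  · exact (hn i).le
  · exact le_rfl

lemma mB_nonneg {n : Fin ℓ → ℝ} (hn : ∀ j, 0 < n j) (S : Fin ℓ → Fin k) (i : Fin k) :
    0 ≤ mB n S i := Finset.sum_nonneg fun j _ => (hn j).le

lemma massOf_add (a b : Pt m →₀ ℝ) : massOf (a + b) = massOf a + massOf b :=
  Finsupp.sum_add_index' (fun _ => rfl) (fun _ _ _ => rfl)

lemma massOf_sum {ι : Type*} (s : Finset ι) (a : ι → Pt m →₀ ℝ) :
    massOf (∑ i ∈ s, a i) = ∑ i ∈ s, massOf (a i) := by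
  induction s using Finset.induction_on with
  | empty => simp [massOf]
  | insert i s hi ih => rw [Finset.sum_insert hi, Finset.sum_insert hi, massOf_add, ih]

lemma massOf_single (z : Pt m) (t : ℝ) : massOf (Finsupp.single z t) = t :=
  Finsupp.sum_single_index rfl

lemma massOf_bMeas (y : Fin ℓ → Pt m) (n : Fin ℓ → ℝ) : massOf (bMeas y n) = ∑ j, n j := by
  simp [bMeas, massOf_sum, massOf_single]

lemma massOf_bPart (y : Fin ℓ → Pt m) (n : Fin ℓ → ℝ) (S : Fin ℓ → Fin k) (i : Fin k) :
    massOf (bPart y n S i) = mB n S i := by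
  simp [bPart, mB, massOf_sum, massOf_single]

/-- Every flow from the factories to the households can be turned into an allocation path
which is no more expensive and in which no two factories in use are connected. -/
lemma IsFlow.exists_allocPath {X : Set (Pt m)} {α : ℝ} (hα : 0 ≤ α) (hα1 : α < 1)
    {x : Fin k → Pt m} {y : Fin ℓ → Pt m} {n : Fin ℓ → ℝ} (hnsum : ∑ j, n j = 1)
    {V : Finset (Pt m)} (hVX : ↑V ⊆ X) {f : Pt m → Pt m → ℝ} {a : Pt m →₀ ℝ}
    (h : IsFlow V f a (bMeas y n)) (ha : ∀ z, a z ≠ 0 → z ∈ Set.range x) :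
    ∃ (G : WDG m) (a' : Pt m →₀ ℝ), (∀ z, 0 ≤ a' z) ∧ ↑a'.support ⊆ Set.range x ∧ massOf a' = 1 ∧
      IsTransportPath X G a' (bMeas y n) ∧ SeparatesSources G.undirected a' ∧
      G.cost α ≤ flowCost α V f := by
  obtain ⟨f', a', h1, h2, h3, h4, h5⟩ := h.exists_reduced hα hα1
  refine ⟨WDG.ofFlow V f', a', h1.nonneg, ?_, ?_, WDG.isTransportPath_ofFlow h1 hVX h4, ?_, ?_⟩
  · exact fun z hz => ha z (h2 z (Finsupp.mem_support_iff.1 hz))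
  · rw [h1.massOf_eq, massOf_bMeas, hnsum]
  · exact fun p q hp hq hr => h5 p q hp hq (hr.mono (WDG.undirected_ofFlow_le h1.anti))
  · rwa [WDG.cost_ofFlow]

lemma flowCost_sum_le {α : ℝ} (hα : 0 ≤ α) (hα1 : α ≤ 1) (V : Finset (Pt m)) {ι : Type*}
    (s : Finset ι) (f : ι → Pt m → Pt m → ℝ) :
    flowCost α V (fun u v => ∑ i ∈ s, f i u v) ≤ ∑ i ∈ s, flowCost α V (f i) := by
  unfold flowCost
  rw [Finset.sum_comm]
  refine Finset.sum_le_sum fun e _ => ?_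
  rw [← Finset.mul_sum]
  exact mul_le_mul_of_nonneg_left (posRpow_sum_le hα hα1 s _) dist_nonneg

lemma IsFlow.sum {V : Finset (Pt m)} {ι : Type*} (s : Finset ι) {f : ι → Pt m → Pt m → ℝ}
    {a b : ι → Pt m →₀ ℝ} (h : ∀ i ∈ s, IsFlow V (f i) (a i) (b i)) :
    IsFlow V (fun u v => ∑ i ∈ s, f i u v) (∑ i ∈ s, a i) (∑ i ∈ s, b i) where
  anti u v := by
    rw [← Finset.sum_neg_distrib]
    exact Finset.sum_congr rfl fun i hi => (h i hi).anti u v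
  mem u v huv := by
    obtain ⟨i, hi, hne⟩ := Finset.exists_ne_zero_of_sum_ne_zero huv
    exact (h i hi).mem u v hne
  div v := by
    rw [Finset.sum_comm, Finsupp.finsetSum_apply, Finsupp.finsetSum_apply,
      ← Finset.sum_sub_distrib]
    exact Finset.sum_congr rfl fun i hi => (h i hi).div v
  nonneg z := by
    rw [Finsupp.finsetSum_apply]
    exact Finset.sum_nonneg fun i hi => (h i hi).nonneg z
  source_mem z hz := by
    rw [Finsupp.finsetSum_apply] at hz
    obtain ⟨i, hi, hne⟩ := Finset.exists_ne_zero_of_sum_ne_zero hz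
    exact (h i hi).source_mem z hne
  sink_mem z hz := by
    rw [Finsupp.finsetSum_apply] at hz
    obtain ⟨i, hi, hne⟩ := Finset.exists_ne_zero_of_sum_ne_zero hz
    exact (h i hi).sink_mem z hne

/-- Transport paths realizing an assignment map can be merged into an allocation path. -/
lemma exists_allocPath_of_parts {X : Set (Pt m)} {α : ℝ} (hα : 0 ≤ α) (hα1 : α < 1)
    {x : Fin k → Pt m} {y : Fin ℓ → Pt m} {n : Fin ℓ → ℝ} (hn : ∀ j, 0 < n j)
    (hnsum : ∑ j, n j = 1) (S : Fin ℓ → Fin k) (Gi : Fin k → WDG m)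
    (h : ∀ i, IsTransportPath X (Gi i) (Finsupp.single (x i) (mB n S i)) (bPart y n S i)) :
    ∃ G : WDG m, IsAllocPath X x y n G ∧ G.cost α ≤ ∑ i, (Gi i).cost α := by
  set V := Finset.univ.biUnion fun i => (Gi i).V with hV
  have hsub : ∀ i, (Gi i).V ⊆ V := fun i => Finset.subset_biUnion_of_mem (fun i => (Gi i).V)
    (Finset.mem_univ i)
  have hVX : ↑V ⊆ X := by
    intro z hz
    simp only [hV, Finset.coe_biUnion, Set.mem_iUnion] at hz
    obtain ⟨i, _, hi⟩ := hz
    exact (h i).2.1 hi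
  have hflow := IsFlow.sum Finset.univ fun i _ => WDG.isFlow_toFlow (h i) (by
    intro z
    rw [Finsupp.single_apply]
    split_ifs
    · exact mB_nonneg hn S i
    · exact le_rfl) (hsub i)
  rw [sum_bPart] at hflow
  obtain ⟨G, a', h1, h2, h3, h4, -, h5⟩ := hflow.exists_allocPath (x := x) hα hα1 hnsum hVX (by
    intro z hz
    rw [Finsupp.finsetSum_apply] at hz
    obtain ⟨i, _, hne⟩ := Finset.exists_ne_zero_of_sum_ne_zero hz
    rw [Finsupp.single_apply] at hne
    split_ifs at hne with hi
    · exact ⟨i, hi⟩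
    · exact absurd rfl hne)
  refine ⟨G, ⟨a', h1, h2, h3, h4⟩, h5.trans ((flowCost_sum_le hα hα1.le V _ _).trans ?_)⟩
  exact Finset.sum_le_sum fun i _ => WDG.flowCost_toFlow_le (h i).1 (hsub i) hα

/-- The star from `x i` to its households can be reduced to a transport path. -/
lemma exists_transportPath_bPart {X : Set (Pt m)} {x : Fin k → Pt m} (hxX : ∀ i, x i ∈ X)
    {y : Fin ℓ → Pt m} (hyX : ∀ j, y j ∈ X) {n : Fin ℓ → ℝ} (hn : ∀ j, 0 < n j)
    (S : Fin ℓ → Fin k) (i : Fin k) :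
    ∃ G, IsTransportPath X G (Finsupp.single (x i) (mB n S i)) (bPart y n S i) := by
  set V : Finset (Pt m) := insert (x i) (Finset.univ.image y) with hV
  have hxV : x i ∈ V := Finset.mem_insert_self _ _
  have hyV : ∀ j, y j ∈ V := fun j => by simp [hV]
  have hflow : ∀ j ∈ Finset.univ.filter (fun j => S j = i),
      IsFlow V (fun u v => n j * edgeFlow (x i) (y j) u v) (Finsupp.single (x i) (n j))
        (Finsupp.single (y j) (n j)) := by
    intro j _
    have hsingle : ∀ z p : Pt m, Finsupp.single p (n j) z ≠ 0 → z = p := by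
      intro z p hz
      by_contra hcon
      exact hz (Finsupp.single_eq_of_ne hcon)
    refine ⟨?_, ?_, ?_, ?_, fun z hz => hsingle z _ hz ▸ hxV, fun z hz => hsingle z _ hz ▸ hyV j⟩
    · intro u v
      rw [edgeFlow_anti (x i) (y j) u v]; ring
    · intro u v huv
      rcases edgeFlow_ne_zero (right_ne_zero_of_mul huv) with ⟨h, -⟩ | ⟨h, -⟩
      · exact h ▸ hxV
      · exact h ▸ hyV j
    · intro v
      rw [← Finset.mul_sum, edgeFlow_div hxV (hyV j), mul_sub]
      simp [Finsupp.single_apply]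
    · intro z
      rw [Finsupp.single_apply]
      split_ifs
      · exact (hn j).le
      · exact le_rfl
  have hsum := IsFlow.sum _ hflow
  obtain ⟨f', a', h1, h2, -, h4, -⟩ := hsum.exists_reduced le_rfl zero_lt_one
  have ha' : ∀ z, a' z ≠ 0 → z = x i := by
    intro z hz
    have := h2 z hz
    by_contra hcon
    simp [Finsupp.finsetSum_apply, Finsupp.single_eq_of_ne hcon] at this
  have hmass : a' (x i) = mB n S i := by
    rw [← massOf_bPart y n S i]
    refine Eq.trans ?_ h1.massOf_eq
    rw [massOf_eq_sum (V := {x i}) fun z hz => Finset.mem_singleton.2 (ha' z hz),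
      Finset.sum_singleton]
  have haeq : a' = Finsupp.single (x i) (mB n S i) := by
    ext z
    by_cases hz : z = x i
    · rw [hz, hmass, Finsupp.single_eq_same]
    · rw [Finsupp.single_eq_of_ne hz]
      by_contra hcon
      exact hz (ha' z hcon)
  refine ⟨WDG.ofFlow V f', haeq ▸ WDG.isTransportPath_ofFlow h1 ?_ h4⟩
  intro z hz
  simp only [hV, Finset.coe_insert, Finset.coe_image, Finset.coe_univ, Set.image_univ,
    Set.mem_insert_iff, Set.mem_range] at hz
  rcases hz with rfl | ⟨j, rfl⟩
  · exact hxX i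
  · exact hyX j

/-- A transport path in which no two sources are connected splits into single source paths. -/
lemma exists_decomposition {X : Set (Pt m)} {x : Fin k → Pt m} (hxinj : Function.Injective x)
    {y : Fin ℓ → Pt m} {n : Fin ℓ → ℝ} (hn : ∀ j, 0 < n j) {G : WDG m} {a : Pt m →₀ ℝ}
    (ha : ∀ z, 0 ≤ a z) (hax : ↑a.support ⊆ Set.range x)
    (hG : IsTransportPath X G a (bMeas y n)) (hsep : SeparatesSources G.undirected a) :
    ∃ (S : Fin ℓ → Fin k) (Gi : Fin k → WDG m),
      (∀ i, IsTransportPath X (Gi i) (Finsupp.single (x i) (mB n S i)) (bPart y n S i)) ∧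
      (∀ i, (¬ ∃ j, S j = i) → (Gi i).V = ∅ ∧ (Gi i).E = ∅) ∧
      (∀ i i', i ≠ i' → Disjoint (Gi i).V (Gi i').V) ∧
      (∀ i, (Gi i).V ⊆ G.V) ∧ (∀ i, (Gi i).E ⊆ G.E) ∧ (∀ i, (Gi i).w = G.w) ∧
      ∀ e ∈ G.E, (∃ p, a p ≠ 0 ∧ G.undirected.Reachable p e.1) → ∃ i, e ∈ (Gi i).E := by
  have hflow := WDG.isFlow_toFlow hG ha (Finset.Subset.refl G.V)
  set K : Fin k → Pt m → Prop := fun i z => a (x i) ≠ 0 ∧ G.undirected.Reachable (x i) z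
  have hKuniq : ∀ i i' z, K i z → K i' z → i = i' := fun i i' z h h' =>
    hxinj (hsep _ _ h.1 h'.1 (h.2.trans h'.2.symm))
  have hKedge : ∀ i, ∀ e ∈ G.E, K i e.1 ↔ K i e.2 := by
    intro i e he
    have hadj : G.undirected.Adj e.1 e.2 := (WDG.undirected_adj hG.1 _ _).2 (Or.inl he)
    exact ⟨fun h => ⟨h.1, h.2.trans hadj.reachable⟩, fun h => ⟨h.1, h.2.trans hadj.symm.reachable⟩⟩
  have hKflow : ∀ i u v, G.toFlow u v ≠ 0 → K i u → K i v := by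
    intro i u v huv hu
    rcases WDG.toFlow_ne_zero huv with h | h
    · exact (hKedge i _ h).1 hu
    · exact (hKedge i _ h).2 hu
  have hsrc : ∀ j, ∃ i, K i (y j) := by
    intro j
    obtain ⟨p, hp, hr⟩ := hflow.exists_source (bMeas_nonneg hn) (bMeas_ne_zero hn j)
    obtain ⟨i, rfl⟩ := hax (Finsupp.mem_support_iff.2 hp)
    exact ⟨i, hp, hr.mono (WDG.flowGraph_toFlow_le hG.1)⟩
  choose S hS using hsrc
  have hSK : ∀ j i, S j = i ↔ K i (y j) := fun j i =>
    ⟨fun h => h ▸ hS j, fun h => hKuniq _ _ _ (hS j) h⟩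
  have hyV : ∀ j, y j ∈ G.V := fun j => hflow.sink_mem _ (bMeas_ne_zero hn j)
  have hmass : ∀ i, a (x i) = mB n S i := by
    intro i
    by_cases hi : a (x i) = 0
    · rw [hi, mB, Finset.filter_false_of_mem, Finset.sum_empty]
      exact fun j _ hj => ((hSK j i).1 hj).1 hi
    · have h1 := hflow.sum_closed (hKflow i)
      rw [Finset.sum_eq_single (x i)] at h1
      · rw [h1, mB]
        simp only [bMeas_apply]
        rw [Finset.sum_comm, Finset.sum_filter]
        refine Finset.sum_congr rfl fun j _ => ?_
        rw [Finset.sum_ite_eq]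
        simp only [Finset.mem_filter, hyV j, true_and, hSK j i]
      · intro z hz hne
        by_contra hcon
        have hz2 := (mem_filter_prop.1 hz).2
        exact hne (hsep _ _ hi hcon hz2.2).symm
      · intro hcon
        exact absurd (mem_filter_prop.2 ⟨hflow.source_mem _ hi, hi,
          SimpleGraph.Reachable.refl _⟩) hcon
  have hbK : ∀ i z, bPart y n S i z = if K i z then bMeas y n z else 0 := by
    intro i z
    rw [bPart_apply, bMeas_apply]
    split_ifs with hz
    · refine Finset.sum_congr rfl fun j _ => ?_
      by_cases hj : y j = z
      · rw [if_pos ((hSK j i).2 (hj ▸ hz))]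
      · simp [hj]
    · refine Finset.sum_eq_zero fun j _ => ?_
      split_ifs with h1 h2
      · exact absurd (h2 ▸ (hSK j i).1 h1) hz
      · rfl
      · rfl
  have haK : ∀ i z, Finsupp.single (x i) (mB n S i) z = if K i z then a z else 0 := by
    intro i z
    rw [← hmass i]
    by_cases hz : z = x i
    · rw [hz, Finsupp.single_eq_same]
      split_ifs with h
      · rfl
      · by_contra hcon
        exact h ⟨hcon, SimpleGraph.Reachable.refl _⟩
    · rw [Finsupp.single_eq_of_ne hz]
      split_ifs with h
      · by_contra hcon
        exact hz (hsep _ _ h.1 (Ne.symm hcon) h.2).symm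
      · rfl
  refine ⟨S, fun i => G.restrict (K i), ?_, ?_, ?_, ?_, ?_, fun i => rfl, ?_⟩
  · intro i
    refine WDG.restrict_isTransportPath hG (hKedge i) ?_ ?_ ?_
    · intro z hz
      rw [haK] at hz
      split_ifs at hz with h
      · exact ⟨hz, h⟩
      · exact absurd rfl hz
    · intro z hz
      rw [hbK] at hz
      split_ifs at hz with h
      · exact ⟨hz, h⟩
      · exact absurd rfl hz
    · intro z
      rw [haK, hbK]
      split_ifs <;> simp
  · intro i hi
    have h0 : a (x i) = 0 := by
      rw [hmass, mB, Finset.filter_false_of_mem, Finset.sum_empty]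
      exact fun j _ hj => hi ⟨j, hj⟩
    exact ⟨filter_prop_eq_empty fun z _ hz => hz.1 h0,
      filter_prop_eq_empty fun e _ he => he.1 h0⟩
  · intro i i' hne
    rw [Finset.disjoint_left]
    intro z hz hz'
    exact hne (hKuniq i i' z (mem_filter_prop.1 hz).2 (mem_filter_prop.1 hz').2)
  · exact fun i => filter_prop_subset _ _
  · exact fun i => filter_prop_subset _ _
  · rintro e he ⟨p, hp, hr⟩
    obtain ⟨i, rfl⟩ := hax (Finsupp.mem_support_iff.2 hp)
    exact ⟨i, mem_filter_prop.2 ⟨he, hp, hr⟩⟩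

lemma sum_cost_eq_biUnion (α : ℝ) {G : WDG m} {Gi : Fin k → WDG m} (hok : ∀ i, (Gi i).edgesOK)
    (hdisj : ∀ i i', i ≠ i' → Disjoint (Gi i).V (Gi i').V)
    (hw : ∀ i, ∀ e ∈ (Gi i).E, (Gi i).w e = G.w e) :
    ∑ i, (Gi i).cost α =
      ∑ e ∈ Finset.univ.biUnion (fun i => (Gi i).E), G.w e ^ α * dist e.1 e.2 := by
  rw [Finset.sum_biUnion]
  · refine Finset.sum_congr rfl fun i _ => Finset.sum_congr rfl fun e he => ?_
    rw [hw i e he]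
  · intro i _ i' _ hne
    rw [Function.onFun, Finset.disjoint_left]
    intro e he he'
    exact Finset.disjoint_left.1 (hdisj i i' hne) (hok i e he).1 (hok i' e he').1

lemma dCost_eq_of_isOptimalTP {X : Set (Pt m)} {α : ℝ} {G : WDG m} {a b : Pt m →₀ ℝ}
    (h : IsOptimalTP X α G a b) : dCost X α a b = G.cost α :=
  IsLeast.csInf_eq ⟨⟨G, h.1, rfl⟩, by rintro _ ⟨G', hG', rfl⟩; exact h.2 G' hG'⟩

lemma dCost_le {X : Set (Pt m)} (α : ℝ) {G : WDG m} {a b : Pt m →₀ ℝ}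
    (h : IsTransportPath X G a b) : dCost X α a b ≤ G.cost α :=
  csInf_le ⟨0, by rintro _ ⟨G', hG', rfl⟩; exact WDG.cost_nonneg hG'.1 α⟩ ⟨G, h, rfl⟩

lemma isTransportPath_of_isEmpty {X : Set (Pt m)} {G : WDG m} (hV : G.V = ∅) (hE : G.E = ∅) :
    IsTransportPath X G 0 0 := by
  refine ⟨by simp [WDG.edgesOK, hE], by simp [hV], by simp, by simp, ?_, by
    simp [WDG.outflow, WDG.inflow, hE]⟩
  have : G.undirected = ⊥ := by
    ext u v
    simp [WDG.undirected, hE]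
  rw [this]
  exact SimpleGraph.isAcyclic_bot

lemma isOptimalTP_of_isEmpty {X : Set (Pt m)} {G : WDG m} (α : ℝ) (hV : G.V = ∅) (hE : G.E = ∅) :
    IsOptimalTP X α G 0 0 := by
  refine ⟨isTransportPath_of_isEmpty hV hE, fun G' hG' => ?_⟩
  have : G.cost α = 0 := by simp [WDG.cost, hE]
  rw [this]
  exact WDG.cost_nonneg hG'.1 α

lemma bPart_eq_zero (y : Fin ℓ → Pt m) (n : Fin ℓ → ℝ) {S : Fin ℓ → Fin k} {i : Fin k}
    (hi : ¬ ∃ j, S j = i) : bPart y n S i = 0 := by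
  rw [bPart, Finset.filter_false_of_mem fun j _ hj => hi ⟨j, hj⟩, Finset.sum_empty]

lemma mB_eq_zero (n : Fin ℓ → ℝ) {S : Fin ℓ → Fin k} {i : Fin k}
    (hi : ¬ ∃ j, S j = i) : mB n S i = 0 := by
  rw [mB, Finset.filter_false_of_mem fun j _ hj => hi ⟨j, hj⟩, Finset.sum_empty]

/-- The energy of an assignment map dominates the cost of any optimal allocation path. -/
lemma IsOptimalAllocPath.cost_le_Ealpha {X : Set (Pt m)} {α : ℝ} (hα : 0 ≤ α) (hα1 : α < 1)
    {x : Fin k → Pt m} (hxX : ∀ i, x i ∈ X) {y : Fin ℓ → Pt m} (hyX : ∀ j, y j ∈ X)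
    {n : Fin ℓ → ℝ} (hn : ∀ j, 0 < n j) (hnsum : ∑ j, n j = 1) {G : WDG m}
    (hG : IsOptimalAllocPath X α x y n G) (S : Fin ℓ → Fin k) :
    G.cost α ≤ Ealpha X α x y n S := by
  refine le_of_forall_pos_le_add fun ε hε => ?_
  have hδ : 0 < ε / (k + 1) := by positivity
  have hex : ∀ i, ∃ Gi, IsTransportPath X Gi (Finsupp.single (x i) (mB n S i)) (bPart y n S i) ∧
      Gi.cost α < dCost X α (Finsupp.single (x i) (mB n S i)) (bPart y n S i) + ε / (k + 1) := by
    intro i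
    obtain ⟨G₀, hG₀⟩ := exists_transportPath_bPart hxX hyX hn S i
    obtain ⟨_, ⟨Gi, hGi, rfl⟩, hlt⟩ := Real.lt_sInf_add_pos
      (s := WDG.cost α '' {G | IsTransportPath X G (Finsupp.single (x i) (mB n S i))
        (bPart y n S i)}) ⟨_, G₀, hG₀, rfl⟩ hδ
    exact ⟨Gi, hGi, hlt⟩
  choose Gi hGi hlt using hex
  obtain ⟨G', hG', hle⟩ := exists_allocPath_of_parts hα hα1 hn hnsum S Gi hGi
  calc G.cost α ≤ ∑ i, (Gi i).cost α := (hG.2 G' hG').trans hle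
    _ ≤ ∑ i, (dCost X α (Finsupp.single (x i) (mB n S i)) (bPart y n S i) + ε / (k + 1)) :=
        Finset.sum_le_sum fun i _ => (hlt i).le
    _ = Ealpha X α x y n S + k * (ε / (k + 1)) := by
        rw [Finset.sum_add_distrib]; simp [Ealpha]
    _ ≤ Ealpha X α x y n S + ε := by
        have : k * (ε / (k + 1)) ≤ ε := by
          rw [mul_div_assoc', div_le_iff₀ (by positivity)]; nlinarith
        linarith

/-- Every allocation path costs at least the energy of some assignment map. -/
lemma IsAllocPath.exists_Ealpha_le {X : Set (Pt m)} {α : ℝ} (hα : 0 ≤ α) (hα1 : α < 1)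
    {x : Fin k → Pt m} (hxinj : Function.Injective x) {y : Fin ℓ → Pt m}
    {n : Fin ℓ → ℝ} (hn : ∀ j, 0 < n j) (hnsum : ∑ j, n j = 1) {G : WDG m}
    (hG : IsAllocPath X x y n G) : ∃ S : Fin ℓ → Fin k, Ealpha X α x y n S ≤ G.cost α := by
  obtain ⟨a, ha, hax, -, hTP⟩ := hG
  have hflow := WDG.isFlow_toFlow hTP ha (Finset.Subset.refl G.V)
  obtain ⟨G', a', h1, h2, -, h4, h5, h6⟩ := hflow.exists_allocPath (x := x) hα hα1 hnsum hTP.2.1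
    (fun z hz => hax (Finsupp.mem_support_iff.2 hz))
  obtain ⟨S, Gi, k1, -, k3, -, k5, k6, -⟩ := exists_decomposition hxinj hn h1 h2 h4 h5
  refine ⟨S, ?_⟩
  calc Ealpha X α x y n S ≤ ∑ i, (Gi i).cost α := Finset.sum_le_sum fun i _ => dCost_le α (k1 i)
    _ = ∑ e ∈ Finset.univ.biUnion (fun i => (Gi i).E), G'.w e ^ α * dist e.1 e.2 :=
        sum_cost_eq_biUnion α (fun i => (k1 i).1) k3 (fun i e _ => by rw [k6])
    _ ≤ G'.cost α := by
        refine Finset.sum_le_sum_of_subset_of_nonneg ?_ fun e he _ =>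
          (WDG.edge_cost_pos h4.1 α he).le
        exact Finset.biUnion_subset.2 fun i _ => k5 i
    _ ≤ G.cost α := h6.trans (WDG.flowCost_toFlow_le hTP.1 (Finset.Subset.refl _) hα)

/-- In an optimal allocation path no two sources are connected. -/
lemma IsOptimalAllocPath.separatesSources {X : Set (Pt m)} {α : ℝ} (hα : 0 ≤ α) (hα1 : α < 1)
    {x : Fin k → Pt m} {y : Fin ℓ → Pt m} {n : Fin ℓ → ℝ} (hn : ∀ j, 0 < n j)
    (hnsum : ∑ j, n j = 1) {G : WDG m} (hG : IsOptimalAllocPath X α x y n G) {a : Pt m →₀ ℝ}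
    (ha : ∀ z, 0 ≤ a z) (hax : ↑a.support ⊆ Set.range x)
    (hTP : IsTransportPath X G a (bMeas y n)) : SeparatesSources G.undirected a := by
  have hflow := WDG.isFlow_toFlow hTP ha (Finset.Subset.refl G.V)
  have hmin : ∀ (f : Pt m → Pt m → ℝ) (a' : Pt m →₀ ℝ), IsFlow G.V f a' (bMeas y n) →
      (∀ z, a' z ≠ 0 → a z ≠ 0) → G.cost α ≤ flowCost α G.V f := by
    intro f a' hf ha'
    obtain ⟨G', a'', h1, h2, h3, h4, -, h6⟩ := hf.exists_allocPath (x := x) hα hα1 hnsum hTP.2.1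
      (fun z hz => hax (Finsupp.mem_support_iff.2 (ha' z hz)))
    exact (hG.2 G' ⟨a'', h1, h2, h3, h4⟩).trans h6
  have hle := WDG.undirected_le_flowGraph hTP.1 (Finset.Subset.refl _) hα
    (hmin _ a hflow fun _ => id)
  have hsep : SeparatesSources (flowGraph G.toFlow) a := by
    by_contra hcon
    obtain ⟨f', a', h1, h2, h3⟩ :=
      hflow.exists_lt_of_not_separatesSources hα hα1 (bMeas_nonneg hn) hcon
    have h4 := WDG.flowCost_toFlow_le hTP.1 (Finset.Subset.refl G.V) hα
    linarith [hmin f' a' h1 h2]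
  exact fun p q hp hq hr => hsep p q hp hq (hr.mono hle)

/-- In an optimal allocation path every edge is connected to a source. -/
lemma IsOptimalAllocPath.exists_source {X : Set (Pt m)} {α : ℝ}
    {x : Fin k → Pt m} {y : Fin ℓ → Pt m} {n : Fin ℓ → ℝ} (hn : ∀ j, 0 < n j)
    {G : WDG m} (hG : IsOptimalAllocPath X α x y n G) {a : Pt m →₀ ℝ}
    (ha : ∀ z, 0 ≤ a z) (hax : ↑a.support ⊆ Set.range x) (hmass : massOf a = 1)
    (hTP : IsTransportPath X G a (bMeas y n)) {e : Pt m × Pt m} (he : e ∈ G.E) :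
    ∃ p, a p ≠ 0 ∧ G.undirected.Reachable p e.1 := by
  by_contra hcon
  push Not at hcon
  have hflow := WDG.isFlow_toFlow hTP ha (Finset.Subset.refl G.V)
  set K : Pt m → Prop := fun z => ¬ G.undirected.Reachable z e.1
  have hKa : ∀ z, a z ≠ 0 → K z := hcon
  have hKb : ∀ z, bMeas y n z ≠ 0 → K z := by
    intro z hz hr
    obtain ⟨p, hp, hpz⟩ := hflow.exists_source (bMeas_nonneg hn) hz
    exact hcon p hp ((hpz.mono (WDG.flowGraph_toFlow_le hTP.1)).trans hr)
  have hrestr : IsTransportPath X (G.restrict K) a (bMeas y n) := by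
    refine WDG.restrict_isTransportPath hTP ?_ (fun z hz => ⟨hz, hKa z hz⟩)
      (fun z hz => ⟨hz, hKb z hz⟩) ?_
    · intro e' he'
      have hadj := (WDG.undirected_adj hTP.1 _ _).2 (Or.inl he')
      exact not_congr ⟨hadj.symm.reachable.trans, hadj.reachable.trans⟩
    · intro z
      split_ifs with hz
      · rfl
      · rw [not_imp_comm.1 (hKa z) hz, not_imp_comm.1 (hKb z) hz, sub_zero]
  have h1 := hG.2 _ ⟨a, ha, hax, hmass, hrestr⟩
  have h2 : (G.restrict K).cost α < G.cost α := by
    refine Finset.sum_lt_sum_of_subset (filter_prop_subset _ _) he ?_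
      (WDG.edge_cost_pos hTP.1 α he) fun e' he' _ => (WDG.edge_cost_pos hTP.1 α he').le
    intro hmem
    exact (mem_filter_prop.1 hmem).2 (SimpleGraph.Reachable.refl _)
  exact h1.not_gt h2

end Assignment

/-- An allocation path `G` is optimal iff there are an optimal
assignment map `S` and, for each `i` with `S⁻¹(i) ≠ ∅`, an optimal transport
path `G_i` from `m(b_i) δ_(x_i)` to `b_i` (with `G_i` empty if `S⁻¹(i) = ∅`),
such that the `G_i` are pairwise disjoint and `G` is their union. -/
theorem stmt_8 {m k ℓ : ℕ} (X : Set (Pt m)) (hXc : IsCompact X) (hXconv : Convex ℝ X)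
    (α : ℝ) (hα0 : 0 ≤ α) (hα1 : α < 1)
    (x : Fin k → Pt m) (hxinj : Function.Injective x) (hxX : ∀ i, x i ∈ X)
    (y : Fin ℓ → Pt m) (hyinj : Function.Injective y) (hyX : ∀ j, y j ∈ X)
    (n : Fin ℓ → ℝ) (hn : ∀ j, 0 < n j) (hnsum : ∑ j, n j = 1)
    (G : WDG m) (hG : IsAllocPath X x y n G) :
    IsOptimalAllocPath X α x y n G ↔
      ∃ S : Fin ℓ → Fin k, IsOptimalAssign X α x y n S ∧
        ∃ Gi : Fin k → WDG m, IsDisjointUnion G Gi ∧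
          ∀ i : Fin k,
            ((∃ j, S j = i) →
              IsOptimalTP X α (Gi i) (Finsupp.single (x i) (mB n S i)) (bPart y n S i)) ∧
            ((¬ ∃ j, S j = i) → (Gi i).V = ∅ ∧ (Gi i).E = ∅) := by
  constructor
  · intro hopt
    obtain ⟨a, ha, hax, hmass, hTP⟩ := hG
    have hsep := hopt.separatesSources hα0 hα1 hn hnsum ha hax hTP
    obtain ⟨S, Gi, k1, k2, k3, k4, k5, k6, k7⟩ := exists_decomposition hxinj hn ha hax hTP hsep
    have hE : G.E = Finset.univ.biUnion fun i => (Gi i).E := by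
      refine Finset.Subset.antisymm (fun e he => ?_) (Finset.biUnion_subset.2 fun i _ => k5 i)
      obtain ⟨i, hi⟩ := k7 e he (hopt.exists_source hn ha hax hmass hTP he)
      exact Finset.mem_biUnion.2 ⟨i, Finset.mem_univ i, hi⟩
    have hcost : ∑ i, (Gi i).cost α = G.cost α := by
      rw [sum_cost_eq_biUnion α (fun i => (k1 i).1) k3 (fun i e _ => by rw [k6]), ← hE]
      rfl
    have hTPopt : ∀ i, IsOptimalTP X α (Gi i) (Finsupp.single (x i) (mB n S i))
        (bPart y n S i) := by
      refine fun i => ⟨k1 i, fun G' hG' => ?_⟩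
      obtain ⟨G'', hA, hle⟩ := exists_allocPath_of_parts hα0 hα1 hn hnsum S
        (Function.update Gi i G') (fun i' => by
          by_cases hi : i' = i
          · subst hi; simpa using hG'
          · simpa [hi] using k1 i')
      have h1 := (hopt.2 G'' hA).trans hle
      rw [← hcost, ← Finset.add_sum_erase _ _ (Finset.mem_univ i),
        ← Finset.add_sum_erase _ _ (Finset.mem_univ i), Function.update_self] at h1
      have h2 : ∑ i' ∈ Finset.univ.erase i, (Function.update Gi i G' i').cost α =
          ∑ i' ∈ Finset.univ.erase i, (Gi i').cost α :=
        Finset.sum_congr rfl fun i' hi' => by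
          rw [Function.update_of_ne (Finset.ne_of_mem_erase hi')]
      linarith
    refine ⟨S, fun S' => ?_, Gi, ⟨k3, k4, k5, fun i e _ => by rw [k6], hE⟩,
      fun i => ⟨fun _ => hTPopt i, k2 i⟩⟩
    calc Ealpha X α x y n S = ∑ i, (Gi i).cost α :=
          Finset.sum_congr rfl fun i _ => dCost_eq_of_isOptimalTP (hTPopt i)
      _ = G.cost α := hcost
      _ ≤ Ealpha X α x y n S' := hopt.cost_le_Ealpha hα0 hα1 hxX hyX hn hnsum S'
  · rintro ⟨S, hS, Gi, ⟨k1, -, -, k4, k5⟩, hGi⟩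
    have hTPopt : ∀ i, IsOptimalTP X α (Gi i) (Finsupp.single (x i) (mB n S i))
        (bPart y n S i) := by
      intro i
      by_cases hi : ∃ j, S j = i
      · exact (hGi i).1 hi
      · obtain ⟨hV, hE⟩ := (hGi i).2 hi
        rw [bPart_eq_zero y n hi, mB_eq_zero n hi, Finsupp.single_zero]
        exact isOptimalTP_of_isEmpty α hV hE
    refine ⟨hG, fun G' hG' => ?_⟩
    obtain ⟨S', hS'⟩ := hG'.exists_Ealpha_le hα0 hα1 hxinj hn hnsum
    calc G.cost α = ∑ i, (Gi i).cost α := by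
          rw [sum_cost_eq_biUnion α (fun i => (hTPopt i).1.1) k1 k4, ← k5]
          rfl
      _ = Ealpha X α x y n S :=
          Finset.sum_congr rfl fun i _ => (dCost_eq_of_isOptimalTP (hTPopt i)).symm
      _ ≤ Ealpha X α x y n S' := hS S'
      _ ≤ G'.cost α := hS'

end
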